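/- Let p : ℝ^d → ℝ be a polynomial of degree at most m with mean zero and variance one under N(0,I_d), and let y = p(x) for x ∼ N(0,I_d). Then for any τ ∈ ℝ and ε > 0, Pr[|y| ∈ (τ − ε, τ)] ≤ C·m·ε^{1/m} for a universal constant C > 0. -/

import Mathlib

open MeasureTheory

noncomputable def stdGaussianPi (n : ℕ) : Measure (Fin n → ℝ) :=
  Measure.pi fun _ => ProbabilityTheory.gaussianReal 0 1

open ProbabilityTheory Set Filter Topology
open scoped NNReal ENNReal

theorem integrable_exp_quadratic {p : ℝ} (hp : 0 < p) (b : ℝ) :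
    Integrable (fun x : ℝ => Real.exp (-(p / 2) * x ^ 2 + b * x)) := by
  have h := ((integrable_exp_neg_mul_sq (half_pos hp)).comp_sub_right (b / p)).const_mul
    (Real.exp (b ^ 2 / (2 * p)))
  refine h.congr (ae_of_all _ fun x => ?_)
  simp only [← Real.exp_add]
  congr 1
  field_simp
  ring

theorem integral_exp_quadratic {p : ℝ} (hp : 0 < p) (b : ℝ) :
    ∫ x : ℝ, Real.exp (-(p / 2) * x ^ 2 + b * x) =
      √(2 * Real.pi / p) * Real.exp (b ^ 2 / (2 * p)) := by
  have h : ∀ x : ℝ, Real.exp (-(p / 2) * x ^ 2 + b * x) =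
      Real.exp (b ^ 2 / (2 * p)) * Real.exp (-(p / 2) * (x - b / p) ^ 2) := by
    intro x
    rw [← Real.exp_add]
    congr 1
    field_simp
    ring
  simp_rw [h]
  rw [integral_const_mul, integral_sub_right_eq_self (fun x => Real.exp (-(p / 2) * x ^ 2)),
    integral_gaussian, mul_comm]
  congr 2
  field_simp

theorem gaussianReal_quadratic {c : ℝ} (hc : c < 1 / 2) (b : ℝ) :
    Integrable (fun x : ℝ => Real.exp (c * x ^ 2 + b * x)) (gaussianReal 0 1) ∧
    ∫ x : ℝ, Real.exp (c * x ^ 2 + b * x) ∂(gaussianReal 0 1) =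
      Real.exp (b ^ 2 / (2 * (1 - 2 * c))) / √(1 - 2 * c) := by
  have hp : 0 < 1 - 2 * c := by linarith
  have key : ∀ x : ℝ, gaussianPDFReal 0 1 x * Real.exp (c * x ^ 2 + b * x) =
      (√(2 * Real.pi))⁻¹ * Real.exp (-((1 - 2 * c) / 2) * x ^ 2 + b * x) := by
    intro x
    simp only [gaussianPDFReal, NNReal.coe_one, mul_one, sub_zero]
    rw [mul_assoc, ← Real.exp_add]
    congr 2
    ring
  constructor
  · rw [gaussianReal_of_var_ne_zero 0 one_ne_zero,
      integrable_withDensity_iff_integrable_smul' (measurable_gaussianPDF 0 1)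
      (ae_of_all _ fun x => gaussianPDF_lt_top)]
    simp only [toReal_gaussianPDF, smul_eq_mul, key]
    exact (integrable_exp_quadratic hp b).const_mul _
  · rw [integral_gaussianReal_eq_integral_smul one_ne_zero]
    simp only [smul_eq_mul, key]
    rw [integral_const_mul, integral_exp_quadratic hp, Real.sqrt_div (by positivity)]
    have : √(2 * Real.pi) ≠ 0 := by positivity
    field_simp

/-- Density at `s` of `N(ρ ξ, 1 - ρ²)` relative to `N(0, 1)` (the Mehler kernel). -/
noncomputable def mehlerKernel (ρ ξ s : ℝ) : ℝ :=
  Real.exp (s ^ 2 / 2 - (s - ρ * ξ) ^ 2 / (2 * (1 - ρ ^ 2))) / √(1 - ρ ^ 2)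

theorem integral_mehlerKernel {ρ : ℝ} (h1 : ρ ^ 2 < 1) (ξ : ℝ) (ψ : ℝ → ℝ) :
    ∫ t, ψ (ρ * ξ + √(1 - ρ ^ 2) * t) ∂(gaussianReal 0 1) =
      ∫ s, mehlerKernel ρ ξ s * ψ s ∂(gaussianReal 0 1) := by
  have hσ : 0 < 1 - ρ ^ 2 := by linarith
  have hσ' : 0 < √(1 - ρ ^ 2) := Real.sqrt_pos.2 hσ
  set v : ℝ≥0 := Real.toNNReal (1 - ρ ^ 2) with hv
  have hvc : (v : ℝ) = 1 - ρ ^ 2 := Real.coe_toNNReal _ hσ.le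
  have hv0 : v ≠ 0 := by
    intro h
    rw [h, NNReal.coe_zero] at hvc
    linarith
  have hmap : (gaussianReal 0 1).map (fun t => ρ * ξ + √(1 - ρ ^ 2) * t) =
      gaussianReal (ρ * ξ) v := by
    have h2 := gaussianReal_map_const_mul (μ := 0) (v := 1) (√(1 - ρ ^ 2))
    have h3 := gaussianReal_map_const_add (μ := √(1 - ρ ^ 2) * 0)
      (v := NNReal.mk (√(1 - ρ ^ 2) ^ 2) (sq_nonneg _) * 1) (ρ * ξ)
    rw [← h2, Measure.map_map (by fun_prop) (by fun_prop)] at h3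
    have hv' : NNReal.mk (√(1 - ρ ^ 2) ^ 2) (sq_nonneg _) * 1 = v := by
      apply NNReal.eq
      rw [NNReal.coe_mul, NNReal.coe_mk, NNReal.coe_one, mul_one, hvc, Real.sq_sqrt hσ.le]
    rw [hv', mul_zero, zero_add] at h3
    exact h3
  have hemb : MeasurableEmbedding (fun t : ℝ => ρ * ξ + √(1 - ρ ^ 2) * t) :=
    ((Homeomorph.mulLeft₀ _ hσ'.ne').trans (Homeomorph.addLeft (ρ * ξ))).measurableEmbedding
  rw [← hemb.integral_map (g := ψ), hmap, integral_gaussianReal_eq_integral_smul hv0,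
    integral_gaussianReal_eq_integral_smul one_ne_zero]
  congr 1 with s
  simp only [smul_eq_mul, gaussianPDFReal, mehlerKernel, ← mul_assoc, hvc]
  congr 1
  rw [Real.sqrt_mul (by positivity)]
  simp only [NNReal.coe_one, mul_one, sub_zero]
  rw [show -(s - ρ * ξ) ^ 2 / (2 * (1 - ρ ^ 2)) =
    -s ^ 2 / 2 + (s ^ 2 / 2 - (s - ρ * ξ) ^ 2 / (2 * (1 - ρ ^ 2))) by ring, Real.exp_add]
  field_simp

theorem integral_mehlerKernel_sq {ρ : ℝ} (h1 : ρ ^ 2 < 1) (ξ : ℝ) :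
    Integrable (fun s => mehlerKernel ρ ξ s ^ 2) (gaussianReal 0 1) ∧
    ∫ s, mehlerKernel ρ ξ s ^ 2 ∂(gaussianReal 0 1) =
      Real.exp (ρ ^ 2 / (1 + ρ ^ 2) * ξ ^ 2) / √(1 - ρ ^ 4) := by
  have hσ : 0 < 1 - ρ ^ 2 := by linarith
  have hσ2 : 0 < 1 + ρ ^ 2 := by positivity
  have key : ∀ s, mehlerKernel ρ ξ s ^ 2 =
      (Real.exp (-(ρ * ξ) ^ 2 / (1 - ρ ^ 2)) / (1 - ρ ^ 2)) *
      Real.exp ((1 - 1 / (1 - ρ ^ 2)) * s ^ 2 + (2 * ρ * ξ / (1 - ρ ^ 2)) * s) := by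
    intro s
    rw [mehlerKernel, div_pow, Real.sq_sqrt hσ.le, ← Real.exp_nat_mul, div_mul_eq_mul_div,
      ← Real.exp_add]
    congr 2
    push_cast
    field_simp
    ring
  have hc : 1 - 1 / (1 - ρ ^ 2) < 1 / 2 := by
    have : 1 ≤ 1 / (1 - ρ ^ 2) := by
      rw [le_div_iff₀ hσ]; nlinarith [sq_nonneg ρ]
    linarith
  obtain ⟨hi, he⟩ := gaussianReal_quadratic hc (2 * ρ * ξ / (1 - ρ ^ 2))
  simp only [key]
  refine ⟨hi.const_mul _, ?_⟩
  rw [integral_const_mul, he]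
  have e1 : 1 - 2 * (1 - 1 / (1 - ρ ^ 2)) = (1 + ρ ^ 2) / (1 - ρ ^ 2) := by
    field_simp; ring
  rw [e1, Real.sqrt_div hσ2.le, show 1 - ρ ^ 4 = (1 - ρ ^ 2) * (1 + ρ ^ 2) by ring,
    Real.sqrt_mul hσ.le]
  have e2 : Real.exp (ρ ^ 2 / (1 + ρ ^ 2) * ξ ^ 2) =
      Real.exp (-(ρ * ξ) ^ 2 / (1 - ρ ^ 2)) *
      Real.exp ((2 * ρ * ξ / (1 - ρ ^ 2)) ^ 2 / (2 * ((1 + ρ ^ 2) / (1 - ρ ^ 2)))) := by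
    rw [← Real.exp_add]
    congr 1
    field_simp
    ring
  rw [e2]
  have h3 : √(1 - ρ ^ 2) ≠ 0 := (Real.sqrt_pos.2 hσ).ne'
  have h4 : √(1 + ρ ^ 2) ≠ 0 := (Real.sqrt_pos.2 hσ2).ne'
  have h5 : (1 - ρ ^ 2) = √(1 - ρ ^ 2) * √(1 - ρ ^ 2) := (Real.mul_self_sqrt hσ.le).symm
  field_simp
  rw [Real.sq_sqrt hσ.le]

/-- `f` is integrable with integral `a`. -/
def HasMean {Ω : Type*} [MeasurableSpace Ω] (μ : Measure Ω) (f : Ω → ℝ) (a : ℝ) : Prop :=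
  Integrable f μ ∧ ∫ x, f x ∂μ = a

namespace HasMean

variable {Ω : Type*} [MeasurableSpace Ω] {μ : Measure Ω} {f g : Ω → ℝ} {a b : ℝ}

theorem add (hf : HasMean μ f a) (hg : HasMean μ g b) :
    HasMean μ (fun x => f x + g x) (a + b) :=
  ⟨hf.1.add hg.1, by rw [integral_add hf.1 hg.1, hf.2, hg.2]⟩

theorem sub (hf : HasMean μ f a) (hg : HasMean μ g b) :
    HasMean μ (fun x => f x - g x) (a - b) :=
  ⟨hf.1.sub hg.1, by rw [integral_sub hf.1 hg.1, hf.2, hg.2]⟩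

theorem const_mul (c : ℝ) (hf : HasMean μ f a) : HasMean μ (fun x => c * f x) (c * a) :=
  ⟨hf.1.const_mul c, by rw [integral_const_mul, hf.2]⟩

theorem const [IsProbabilityMeasure μ] (c : ℝ) : HasMean μ (fun _ => c) c :=
  ⟨integrable_const c, by simp⟩

theorem congr (hf : HasMean μ f a) (h : ∀ x, f x = g x) (h' : a = b) : HasMean μ g b := by
  have : f = g := funext h
  rwa [← this, ← h']

end HasMean

theorem memLp_two_stdGaussian_id : MemLp (fun x : ℝ => x) 2 (gaussianReal 0 1) :=
  memLp_id_gaussianReal (μ := 0) (v := 1) 2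

theorem integral_stdGaussian_id : ∫ x, x ∂(gaussianReal 0 1) = 0 :=
  integral_id_gaussianReal

theorem integral_stdGaussian_sq : ∫ x, x ^ 2 ∂(gaussianReal 0 1) = 1 := by
  have h := variance_eq_sub memLp_two_stdGaussian_id
  have h2 : Var[fun x : ℝ => x; gaussianReal 0 1] = 1 := variance_id_gaussianReal (μ := 0) (v := 1)
  rw [h2, integral_stdGaussian_id] at h
  simp only [Pi.pow_apply] at h
  linarith

theorem memLp_mehlerKernel {ρ : ℝ} (h1 : ρ ^ 2 < 1) (ξ : ℝ) :
    MemLp (mehlerKernel ρ ξ) 2 (gaussianReal 0 1) := by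
  rw [memLp_two_iff_integrable_sq]
  · exact (integral_mehlerKernel_sq h1 ξ).1
  · refine Continuous.aestronglyMeasurable ?_
    unfold mehlerKernel
    fun_prop

theorem sq_integral_abs_le {Ω : Type*} [MeasurableSpace Ω] {μ : Measure Ω}
    [IsProbabilityMeasure μ] {h : Ω → ℝ} (hh : MemLp h 2 μ) :
    (∫ x, |h x| ∂μ) ^ 2 ≤ ∫ x, h x ^ 2 ∂μ := by
  have h1 := variance_nonneg |h| μ
  rw [variance_eq_sub hh.abs] at h1
  simp only [Pi.pow_apply, Pi.abs_apply, sq_abs] at h1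
  linarith

/-- If `ψ` has no first-order Hermite component, the Ornstein–Uhlenbeck average of `ψ` with
correlation `ρ` has variance of order `ρ ^ 4`. -/
theorem mehler_smoothing {ρ : ℝ} (h1 : ρ ^ 2 < 1) {ψ : ℝ → ℝ} (hm : Measurable ψ)
    (h01 : ∀ s, |ψ s| ≤ 1) (hz : ∫ s, ψ s * s ∂(gaussianReal 0 1) = 0) :
    ∫ ξ, ((∫ t, ψ (ρ * ξ + √(1 - ρ ^ 2) * t) ∂(gaussianReal 0 1)) -
      ∫ s, ψ s ∂(gaussianReal 0 1)) ^ 2 ∂(gaussianReal 0 1) ≤ ρ ^ 4 / (1 - ρ ^ 2) := by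
  set γ := gaussianReal 0 1 with hγ
  have hσ : 0 < 1 - ρ ^ 2 := by linarith
  have hid := memLp_two_stdGaussian_id
  have hid1 : Integrable (fun x : ℝ => x) γ := hid.integrable (by norm_num)
  have hid2 : Integrable (fun x : ℝ => x ^ 2) γ := hid.integrable_sq
  have hidm : HasMean γ (fun x => x) 0 := ⟨hid1, integral_stdGaussian_id⟩
  have hidm2 : HasMean γ (fun x => x ^ 2) 1 := ⟨hid2, integral_stdGaussian_sq⟩
  have hpoint : ∀ ξ, ((∫ t, ψ (ρ * ξ + √(1 - ρ ^ 2) * t) ∂γ) - ∫ s, ψ s ∂γ) ^ 2 ≤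
      Real.exp (ρ ^ 2 / (1 + ρ ^ 2) * ξ ^ 2) / √(1 - ρ ^ 4) - 1 - ρ ^ 2 * ξ ^ 2 := by
    intro ξ
    have hk := memLp_mehlerKernel h1 ξ
    have hk1 : Integrable (mehlerKernel ρ ξ) γ := hk.integrable (by norm_num)
    have hks : Integrable (fun s => mehlerKernel ρ ξ s * s) γ := hk.integrable_mul hid
    have e1 : ∫ s, mehlerKernel ρ ξ s ∂γ = 1 := by
      have := integral_mehlerKernel h1 ξ (fun _ => 1)
      simpa using this.symm
    have e2 : ∫ s, mehlerKernel ρ ξ s * s ∂γ = ρ * ξ := by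
      have := integral_mehlerKernel h1 ξ (fun s => s)
      rw [← this]
      exact (((HasMean.const (ρ * ξ)).add (hidm.const_mul _)).congr (fun _ => rfl)
        (by ring)).2
    have hh : MemLp (fun s => mehlerKernel ρ ξ s - 1 - ρ * ξ * s) 2 γ :=
      (hk.sub (memLp_const 1)).sub (hid.const_mul _)
    have hbdd : ∀ {f : ℝ → ℝ}, Integrable f γ → Integrable (fun s => ψ s * f s) γ := fun hf =>
      hf.bdd_mul (c := 1) hm.aestronglyMeasurable (ae_of_all _ fun s => by simpa using h01 s)
    have hψ : Integrable ψ γ := by simpa using hbdd (integrable_const 1)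
    have e3 : (∫ t, ψ (ρ * ξ + √(1 - ρ ^ 2) * t) ∂γ) - ∫ s, ψ s ∂γ =
        ∫ s, ψ s * (mehlerKernel ρ ξ s - 1 - ρ * ξ * s) ∂γ := by
      rw [integral_mehlerKernel h1 ξ ψ]
      have m1 : HasMean γ (fun s => ψ s * mehlerKernel ρ ξ s) _ := ⟨hbdd hk1, rfl⟩
      have m2 : HasMean γ (fun s => ψ s * s) 0 := ⟨hbdd hid1, hz⟩
      have m3 : HasMean γ ψ _ := ⟨hψ, rfl⟩
      refine (((m1.sub m3).sub (m2.const_mul (ρ * ξ))).congr (fun s => by ring) ?_).2.symm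
      simp only [mul_comm (ψ _), mul_zero, sub_zero]
      rfl
    have e4 : |∫ s, ψ s * (mehlerKernel ρ ξ s - 1 - ρ * ξ * s) ∂γ| ≤
        ∫ s, |mehlerKernel ρ ξ s - 1 - ρ * ξ * s| ∂γ := by
      refine abs_integral_le_integral_abs.trans (integral_mono (hbdd (hh.integrable ?_)).abs
        (hh.integrable ?_).abs fun s => ?_)
      · norm_num
      · norm_num
      · simp only [abs_mul]
        exact mul_le_of_le_one_left (abs_nonneg _) (h01 s)
    have e5 : ∫ s, (mehlerKernel ρ ξ s - 1 - ρ * ξ * s) ^ 2 ∂γ =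
        Real.exp (ρ ^ 2 / (1 + ρ ^ 2) * ξ ^ 2) / √(1 - ρ ^ 4) - 1 - ρ ^ 2 * ξ ^ 2 := by
      have m1 : HasMean γ _ _ := integral_mehlerKernel_sq h1 ξ
      have m2 : HasMean γ _ _ := ⟨hk1, e1⟩
      have m3 : HasMean γ _ _ := ⟨hks, e2⟩
      exact (((((m1.add (HasMean.const 1)).add (hidm.const_mul (2 * ρ * ξ))).add
        (hidm2.const_mul (ρ ^ 2 * ξ ^ 2))).sub (m2.const_mul 2)).sub
        (m3.const_mul (2 * ρ * ξ))).congr (fun s => by ring) (by ring) |>.2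
    rw [e3, ← sq_abs, ← e5]
    exact (pow_le_pow_left₀ (abs_nonneg _) e4 2).trans (sq_integral_abs_le hh)
  have hc : ρ ^ 2 / (1 + ρ ^ 2) < 1 / 2 := by
    rw [div_lt_div_iff₀ (by positivity) (by norm_num)]
    linarith
  obtain ⟨hi, he⟩ := gaussianReal_quadratic hc 0
  simp only [zero_mul, add_zero] at hi he
  have hI := (((show HasMean γ _ _ from ⟨hi, he⟩).const_mul (√(1 - ρ ^ 4))⁻¹).sub
    (HasMean.const 1)).sub (hidm2.const_mul (ρ ^ 2))
  refine (integral_mono_of_nonneg (ae_of_all _ fun ξ => sq_nonneg _) hI.1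
    (ae_of_all _ fun ξ => (hpoint ξ).trans (le_of_eq (by ring)))).trans (le_of_eq ?_)
  rw [hI.2]
  have hσ2 : 0 < 1 + ρ ^ 2 := by positivity
  have e1 : 1 - 2 * (ρ ^ 2 / (1 + ρ ^ 2)) = (1 - ρ ^ 2) / (1 + ρ ^ 2) := by
    field_simp; ring
  rw [e1, Real.sqrt_div hσ.le, show 1 - ρ ^ 4 = (1 - ρ ^ 2) * (1 + ρ ^ 2) by ring,
    Real.sqrt_mul hσ.le]
  have h3 : √(1 - ρ ^ 2) ≠ 0 := (Real.sqrt_pos.2 hσ).ne'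
  have h4 : √(1 + ρ ^ 2) ≠ 0 := (Real.sqrt_pos.2 hσ2).ne'
  have h5 : √(1 - ρ ^ 2) ^ 2 = 1 - ρ ^ 2 := Real.sq_sqrt hσ.le
  simp
  field_simp
  rw [h5]
  ring

theorem integral_stdGaussian_mix {ρ : ℝ} (h1 : ρ ^ 2 < 1) {ψ : ℝ → ℝ} (hm : Measurable ψ)
    (h01 : ∀ s, |ψ s| ≤ 1) :
    ∫ ξ, ∫ t, ψ (ρ * ξ + √(1 - ρ ^ 2) * t) ∂(gaussianReal 0 1) ∂(gaussianReal 0 1) =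
      ∫ s, ψ s ∂(gaussianReal 0 1) := by
  have hσ : 0 < 1 - ρ ^ 2 := by linarith
  have m1 := gaussianReal_map_const_mul (μ := 0) (v := 1) ρ
  have m2 := gaussianReal_map_const_mul (μ := 0) (v := 1) √(1 - ρ ^ 2)
  have hc := gaussianReal_conv_gaussianReal (m₁ := ρ * 0) (m₂ := √(1 - ρ ^ 2) * 0)
    (v₁ := NNReal.mk (ρ ^ 2) (sq_nonneg _) * 1)
    (v₂ := NNReal.mk (√(1 - ρ ^ 2) ^ 2) (sq_nonneg _) * 1)
  have hv : NNReal.mk (ρ ^ 2) (sq_nonneg _) * 1 +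
      NNReal.mk (√(1 - ρ ^ 2) ^ 2) (sq_nonneg _) * 1 = 1 := by
    apply NNReal.eq
    simp only [NNReal.coe_add, NNReal.coe_mk, NNReal.coe_one, mul_one,
      Real.sq_sqrt hσ.le]
    ring
  rw [hv, mul_zero, mul_zero, zero_add] at hc
  rw [mul_zero] at m1 m2
  rw [← m1, ← m2] at hc
  have hi : Integrable ψ (gaussianReal 0 1) :=
    Integrable.of_bound hm.aestronglyMeasurable 1 (ae_of_all _ fun s => by simpa using h01 s)
  have hi' := hi
  rw [← hc] at hi'
  have h := integral_conv hi'
  rw [hc, integral_map (by fun_prop)] at h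
  · rw [h]
    congr 1 with ξ
    rw [integral_map (by fun_prop)]
    exact (hm.comp (measurable_const_add _)).aestronglyMeasurable
  · refine StronglyMeasurable.aestronglyMeasurable ?_
    refine StronglyMeasurable.integral_prod_right (f := fun x y : ℝ => ψ (x + y)) ?_
    exact (hm.comp measurable_add).stronglyMeasurable

instance (n : ℕ) : IsProbabilityMeasure (stdGaussianPi n) := by
  unfold stdGaussianPi; infer_instance

theorem measurePreserving_eval_stdGaussianPi {n : ℕ} (i : Fin n) :
    MeasurePreserving (Function.eval i) (stdGaussianPi n) (gaussianReal 0 1) :=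
  measurePreserving_eval (fun _ : Fin n => gaussianReal 0 1) i

theorem integrable_eval_stdGaussianPi {n : ℕ} (i : Fin n) :
    Integrable (fun z => z i) (stdGaussianPi n) :=
  (measurePreserving_eval_stdGaussianPi i).integrable_comp_of_integrable
    (memLp_two_stdGaussian_id.integrable (by norm_num))

theorem integral_stdGaussianPi_insertNth {n : ℕ} (i : Fin (n + 1)) {F : (Fin (n + 1) → ℝ) → ℝ}
    (hF : Integrable F (stdGaussianPi (n + 1))) :
    ∫ z, F z ∂(stdGaussianPi (n + 1)) =
      ∫ t, ∫ y, F (i.insertNth t y) ∂(stdGaussianPi n) ∂(gaussianReal 0 1) := by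
  have h := (measurePreserving_piFinSuccAbove (fun _ : Fin (n + 1) => gaussianReal 0 1) i).symm
  have he := (MeasurableEquiv.piFinSuccAbove (fun _ : Fin (n + 1) => ℝ) i).symm.measurableEmbedding
  unfold stdGaussianPi at hF ⊢
  rw [← h.integral_comp he F]
  exact integral_prod _ ((h.integrable_comp_emb he).2 hF)

theorem integral_stdGaussianPi_linearIsometryEquiv {n : ℕ}
    (R : EuclideanSpace ℝ (Fin n) ≃ₗᵢ[ℝ] EuclideanSpace ℝ (Fin n)) (F : (Fin n → ℝ) → ℝ) :
    ∫ z, F (R (WithLp.toLp 2 z)) ∂(stdGaussianPi n) = ∫ z, F z ∂(stdGaussianPi n) := by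
  have h1 : MeasurePreserving (WithLp.toLp 2) (stdGaussianPi n)
      (stdGaussian (EuclideanSpace ℝ (Fin n))) :=
    ⟨by fun_prop, map_pi_eq_stdGaussian⟩
  have h2 : MeasurePreserving R (stdGaussian (EuclideanSpace ℝ (Fin n)))
      (stdGaussian (EuclideanSpace ℝ (Fin n))) :=
    ⟨by fun_prop, stdGaussian_map R⟩
  have e1 : MeasurableEmbedding (WithLp.toLp 2 : (Fin n → ℝ) → EuclideanSpace ℝ (Fin n)) :=
    (MeasurableEquiv.toLp 2 (Fin n → ℝ)).measurableEmbedding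
  rw [h1.integral_comp e1 (fun x => F (R x)),
    h2.integral_comp R.toHomeomorph.measurableEmbedding (fun x => F x),
    ← h1.integral_comp e1 (fun x => F x)]

/-- The average of `f` over the Gaussian vector `a + ∑ z j • S j`. -/
noncomputable def gaussianAverage {n d : ℕ} (f : (Fin d → ℝ) → ℝ) (a : Fin d → ℝ)
    (S : Fin n → Fin d → ℝ) : ℝ :=
  ∫ z, f (a + ∑ j, z j • S j) ∂(stdGaussianPi n)

theorem continuous_gaussianAverage {n d : ℕ} {f : (Fin d → ℝ) → ℝ} (hf : Continuous f)
    (h01 : ∀ x, |f x| ≤ 1) :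
    Continuous fun q : (Fin d → ℝ) × (Fin n → Fin d → ℝ) => gaussianAverage f q.1 q.2 := by
  unfold gaussianAverage
  refine MeasureTheory.continuous_of_dominated (bound := fun _ => 1) (fun q => ?_) (fun q => ?_)
    (integrable_const _) ?_
  · exact Continuous.aestronglyMeasurable (by fun_prop)
  · exact ae_of_all _ fun z => by simpa using h01 _
  · exact ae_of_all _ fun z => by fun_prop

theorem integrable_gaussianAverage_mul_eval {n d : ℕ} {f : (Fin d → ℝ) → ℝ} (hf : Continuous f)
    (h01 : ∀ x, |f x| ≤ 1) (a : Fin d → ℝ) (S : Fin n → Fin d → ℝ) (i : Fin n) :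
    Integrable (fun z => f (a + ∑ j, z j • S j) * z i) (stdGaussianPi n) := by
  refine (integrable_eval_stdGaussianPi i).bdd_mul (c := 1) ?_ (ae_of_all _ fun z => ?_)
  · exact Continuous.aestronglyMeasurable (by fun_prop)
  · simpa using h01 _

/-- Rotating the Gaussian vector so that the first-order moment of `f` points along the
first coordinate. -/
theorem exists_rotation {n d : ℕ} {f : (Fin d → ℝ) → ℝ} (hf : Continuous f)
    (h01 : ∀ x, |f x| ≤ 1) (a : Fin d → ℝ) (S : Fin (n + 1) → Fin d → ℝ) :
    ∃ S' : Fin (n + 1) → Fin d → ℝ,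
      (∀ g : (Fin d → ℝ) → ℝ, gaussianAverage g a S' = gaussianAverage g a S) ∧
      ∑ j, ∑ k, S' j k ^ 2 = ∑ j, ∑ k, S j k ^ 2 ∧
      ∀ i, i ≠ 0 → ∫ z, f (a + ∑ j, z j • S' j) * z i ∂(stdGaussianPi (n + 1)) = 0 := by
  classical
  set v : EuclideanSpace ℝ (Fin (n + 1)) := WithLp.toLp 2
    fun i => ∫ z, f (a + ∑ j, z j • S j) * z i ∂(stdGaussianPi (n + 1)) with hv
  set w : EuclideanSpace ℝ (Fin (n + 1)) := EuclideanSpace.single 0 ‖v‖ with hw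
  have hvw : ‖v‖ = ‖w‖ := by rw [hw, PiLp.norm_single, norm_norm]
  obtain ⟨R, hR⟩ : ∃ R : EuclideanSpace ℝ (Fin (n + 1)) ≃ₗᵢ[ℝ] EuclideanSpace ℝ (Fin (n + 1)),
      R v = w :=
    ⟨(Submodule.span ℝ {v - w})ᗮ.reflection, Submodule.reflection_sub hvw⟩
  have hinner : ∀ x y : EuclideanSpace ℝ (Fin (n + 1)), inner ℝ x y = ∑ i, x i * y i :=
      fun x y => by
    simp [PiLp.inner_apply, mul_comm]
  set S' : Fin (n + 1) → Fin d → ℝ := fun j k => R (WithLp.toLp 2 fun i => S i k) j with hS'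
  have hsum : ∀ z : Fin (n + 1) → ℝ,
      ∑ j, R (WithLp.toLp 2 z) j • S' j = ∑ j, z j • S j := by
    intro z
    ext k
    have := R.inner_map_map (WithLp.toLp 2 z) (WithLp.toLp 2 fun i => S i k)
    rw [hinner, hinner] at this
    simpa [hS', Finset.sum_apply] using this
  refine ⟨S', fun g => ?_, ?_, fun i hi => ?_⟩
  · unfold gaussianAverage
    rw [← integral_stdGaussianPi_linearIsometryEquiv R]
    simp_rw [hsum]
  · rw [Finset.sum_comm, Finset.sum_comm (s := (Finset.univ : Finset (Fin (n + 1))))]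
    refine Finset.sum_congr rfl fun k _ => ?_
    have := R.inner_map_map (WithLp.toLp 2 fun i => S i k) (WithLp.toLp 2 fun i => S i k)
    rw [hinner, hinner] at this
    simpa [hS', sq] using this
  · rw [← integral_stdGaussianPi_linearIsometryEquiv R]
    simp_rw [hsum]
    set c : EuclideanSpace ℝ (Fin (n + 1)) := R.symm (EuclideanSpace.single i 1) with hc
    have hRi : ∀ x : EuclideanSpace ℝ (Fin (n + 1)), R x i = ∑ j, x j * c j := by
      intro x
      rw [← hinner, hc, ← R.inner_map_map, R.apply_symm_apply, hinner]
      simp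
    have h0 : ∑ j, v j * c j = 0 := by
      rw [← hRi, hR, hw]
      simp [hi]
    simp_rw [hRi, Finset.mul_sum]
    rw [integral_finsetSum]
    · rw [← h0]
      refine Finset.sum_congr rfl fun j _ => ?_
      simp_rw [← mul_assoc]
      rw [integral_mul_const]
    · intro j _
      simp_rw [← mul_assoc]
      exact (integrable_gaussianAverage_mul_eval hf h01 a S j).mul_const _

/-- The average of `f` over `a + ∑ z j • S j` conditioned on the coordinate `z i = s`. -/
noncomputable def columnAverage {n d : ℕ} (f : (Fin d → ℝ) → ℝ) (a : Fin d → ℝ)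
    (S : Fin (n + 1) → Fin d → ℝ) (i : Fin (n + 1)) (s : ℝ) : ℝ :=
  ∫ y, f (a + (s • S i + ∑ j, y j • S (i.succAbove j))) ∂(stdGaussianPi n)

theorem continuous_columnAverage {n d : ℕ} {f : (Fin d → ℝ) → ℝ} (hf : Continuous f)
    (h01 : ∀ x, |f x| ≤ 1) (a : Fin d → ℝ) (S : Fin (n + 1) → Fin d → ℝ) (i : Fin (n + 1)) :
    Continuous (columnAverage f a S i) := by
  unfold columnAverage
  refine MeasureTheory.continuous_of_dominated (bound := fun _ => 1) (fun q => ?_) (fun q => ?_)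
    (integrable_const _) ?_
  · exact Continuous.aestronglyMeasurable (by fun_prop)
  · exact ae_of_all _ fun z => by simpa using h01 _
  · exact ae_of_all _ fun z => by fun_prop

theorem abs_columnAverage_le {n d : ℕ} {f : (Fin d → ℝ) → ℝ}
    (h01 : ∀ x, |f x| ≤ 1) (a : Fin d → ℝ) (S : Fin (n + 1) → Fin d → ℝ) (i : Fin (n + 1))
    (s : ℝ) : |columnAverage f a S i s| ≤ 1 := by
  unfold columnAverage
  have := norm_integral_le_of_norm_le_const (μ := stdGaussianPi n) (C := 1)
    (f := fun y => f (a + (s • S i + ∑ j, y j • S (i.succAbove j))))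
    (ae_of_all _ fun y => by simpa using h01 _)
  simpa using this

theorem gaussianAverage_eq_integral_columnAverage {n d : ℕ} {f : (Fin d → ℝ) → ℝ}
    (hf : Continuous f)
    (h01 : ∀ x, |f x| ≤ 1) (a : Fin d → ℝ) (S : Fin (n + 1) → Fin d → ℝ) (i : Fin (n + 1)) :
    gaussianAverage f a S = ∫ t, columnAverage f a S i t ∂(gaussianReal 0 1) := by
  unfold gaussianAverage
  rw [integral_stdGaussianPi_insertNth i]
  · simp only [columnAverage, Fin.sum_univ_succAbove _ i, Fin.insertNth_apply_same,
      Fin.insertNth_apply_succAbove]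
  · refine Integrable.of_bound (Continuous.aestronglyMeasurable (by fun_prop)) 1
      (ae_of_all _ fun z => by simpa using h01 _)

theorem integral_columnAverage_mul {n d : ℕ} {f : (Fin d → ℝ) → ℝ} (hf : Continuous f)
    (h01 : ∀ x, |f x| ≤ 1) (a : Fin d → ℝ) (S : Fin (n + 1) → Fin d → ℝ) (i : Fin (n + 1)) :
    ∫ t, columnAverage f a S i t * t ∂(gaussianReal 0 1) =
      ∫ z, f (a + ∑ j, z j • S j) * z i ∂(stdGaussianPi (n + 1)) := by
  rw [integral_stdGaussianPi_insertNth i (integrable_gaussianAverage_mul_eval hf h01 a S i)]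
  simp only [columnAverage, Fin.sum_univ_succAbove _ i, Fin.insertNth_apply_same,
      Fin.insertNth_apply_succAbove, integral_mul_const]

theorem gaussianAverage_update {n d : ℕ} {f : (Fin d → ℝ) → ℝ} (hf : Continuous f)
    (h01 : ∀ x, |f x| ≤ 1) (a : Fin d → ℝ) (S : Fin (n + 1) → Fin d → ℝ) (i : Fin (n + 1))
    (r σ : ℝ) :
    gaussianAverage f (a + r • S i) (Function.update S i (σ • S i)) =
      ∫ t, columnAverage f a S i (r + σ * t) ∂(gaussianReal 0 1) := by
  rw [gaussianAverage_eq_integral_columnAverage hf h01 _ _ i]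
  congr 1 with t
  simp only [columnAverage, Function.update_self, Function.update_of_ne (Fin.succAbove_ne _ _)]
  congr 1 with y
  congr 1
  rw [add_smul, smul_smul, mul_comm t]
  abel

theorem hasMean_mix_columnAverage {n d : ℕ} {f : (Fin d → ℝ) → ℝ} (hf : Continuous f)
    (h01 : ∀ x, |f x| ≤ 1) (a : Fin d → ℝ) (S : Fin (n + 1) → Fin d → ℝ) (i : Fin (n + 1))
    {ρ : ℝ} (h1 : ρ ^ 2 < 1) :
    HasMean (gaussianReal 0 1) (fun ξ => ∫ t, columnAverage f a S i (ρ * ξ + √(1 - ρ ^ 2) * t)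
      ∂(gaussianReal 0 1)) (gaussianAverage f a S) := by
  have hc := continuous_columnAverage hf h01 a S i
  have hb := abs_columnAverage_le h01 a S i
  refine ⟨?_, ?_⟩
  · refine Integrable.of_bound (C := 1) ?_ (ae_of_all _ fun ξ => ?_)
    · refine Continuous.aestronglyMeasurable ?_
      refine MeasureTheory.continuous_of_dominated (bound := fun _ => 1) (fun q => ?_)
        (fun q => ?_) (integrable_const _) ?_
      · exact Continuous.aestronglyMeasurable (by fun_prop)
      · exact ae_of_all _ fun z => by simpa using hb _
      · exact ae_of_all _ fun z => by fun_prop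
    · have := norm_integral_le_of_norm_le_const (μ := gaussianReal 0 1) (C := 1)
        (f := fun t => columnAverage f a S i (ρ * ξ + √(1 - ρ ^ 2) * t))
        (ae_of_all _ fun y => by simpa using hb _)
      simpa using this
  · rw [integral_stdGaussian_mix h1 hc.measurable hb,
      gaussianAverage_eq_integral_columnAverage hf h01 a S i]

theorem gaussianAverage_mem_Icc {n d : ℕ} {f : (Fin d → ℝ) → ℝ} (hf : Continuous f)
    (hf01 : ∀ x, f x ∈ Icc (0 : ℝ) 1) (a : Fin d → ℝ) (S : Fin n → Fin d → ℝ) :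
    gaussianAverage f a S ∈ Icc (0 : ℝ) 1 := by
  refine ⟨integral_nonneg fun z => (hf01 _).1, ?_⟩
  have : ∫ z, f (a + ∑ j, z j • S j) ∂(stdGaussianPi n) ≤ ∫ z, 1 ∂(stdGaussianPi n) := by
    refine integral_mono ?_ (integrable_const _) fun z => (hf01 _).2
    refine Integrable.of_bound (Continuous.aestronglyMeasurable (by fun_prop)) 1
      (ae_of_all _ fun z => ?_)
    rw [Real.norm_eq_abs, abs_of_nonneg (hf01 _).1]
    exact (hf01 _).2
  simpa [gaussianAverage] using this

/-- The strictly confining penalty used to localize. -/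
def needlePenalty {n d : ℕ} (a : Fin d → ℝ) (S : Fin n → Fin d → ℝ) : ℝ :=
  ∑ k, a k ^ 2 + 2 * ∑ j, ∑ k, S j k ^ 2

theorem needlePenalty_update {n d : ℕ} (a : Fin d → ℝ) (S : Fin n → Fin d → ℝ) (i : Fin n)
    (r σ : ℝ) :
    needlePenalty (a + r • S i) (Function.update S i (σ • S i)) =
      needlePenalty a S + 2 * r * ∑ k, a k * S i k +
        (r ^ 2 + 2 * (σ ^ 2 - 1)) * ∑ k, S i k ^ 2 := by
  classical
  unfold needlePenalty
  have h1 : ∑ j, ∑ k, Function.update S i (σ • S i) j k ^ 2 =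
      ∑ j, ∑ k, S j k ^ 2 + (σ ^ 2 - 1) * ∑ k, S i k ^ 2 := by
    rw [← Finset.add_sum_erase _ _ (Finset.mem_univ i),
      ← Finset.add_sum_erase (a := i) _ (fun j => ∑ k, S j k ^ 2) (Finset.mem_univ i)]
    have : ∑ j ∈ Finset.univ.erase i, ∑ k, Function.update S i (σ • S i) j k ^ 2 =
        ∑ j ∈ Finset.univ.erase i, ∑ k, S j k ^ 2 :=
      Finset.sum_congr rfl fun j hj => by
        rw [Function.update_of_ne (Finset.ne_of_mem_erase hj)]
    rw [this]
    simp only [Function.update_self, Pi.smul_apply, smul_eq_mul, mul_pow, ← Finset.mul_sum]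
    ring
  have h2 : ∑ k, (a + r • S i) k ^ 2 =
      ∑ k, a k ^ 2 + 2 * r * ∑ k, a k * S i k + r ^ 2 * ∑ k, S i k ^ 2 := by
    simp only [Finset.mul_sum, ← Finset.sum_add_distrib]
    refine Finset.sum_congr rfl fun k _ => ?_
    simp only [Pi.add_apply, Pi.smul_apply, smul_eq_mul]
    ring
  rw [h1, h2]
  ring

theorem abs_le_one_of_mem_Icc {x : ℝ} (h : x ∈ Icc (0 : ℝ) 1) : |x| ≤ 1 :=
  abs_le.2 ⟨by linarith [h.1], h.2⟩

theorem column_eq_zero_of_isMax {n d : ℕ} {f g : (Fin d → ℝ) → ℝ} (hf : Continuous f)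
    (hg : Continuous g) (hf01 : ∀ x, f x ∈ Icc (0 : ℝ) 1) (hg01 : ∀ x, g x ∈ Icc (0 : ℝ) 1)
    {Θ L : ℝ → ℝ} {K η : ℝ} (hK : 0 ≤ K) (hη : 0 < η)
    (hΘ : ∀ x ∈ Icc (0 : ℝ) 1, ∀ y ∈ Icc (0 : ℝ) 1,
      Θ y ≤ Θ x + L x * (y - x) + K * (y - x) ^ 2)
    {a : Fin d → ℝ} {S : Fin (n + 1) → Fin d → ℝ}
    (hmax : ∀ (b : Fin d → ℝ) (T : Fin (n + 1) → Fin d → ℝ),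
      gaussianAverage g b T - Θ (gaussianAverage f b T) - η * needlePenalty b T ≤
      gaussianAverage g a S - Θ (gaussianAverage f a S) - η * needlePenalty a S)
    {i : Fin (n + 1)}
    (hi : ∫ z, f (a + ∑ j, z j • S j) * z i ∂(stdGaussianPi (n + 1)) = 0) : S i = 0 := by
  have hfa := fun x => abs_le_one_of_mem_Icc (hf01 x)
  have hga := fun x => abs_le_one_of_mem_Icc (hg01 x)
  set Q := ∑ k, S i k ^ 2 with hQ
  have hQ0 : 0 ≤ Q := Finset.sum_nonneg fun k _ => sq_nonneg _
  set c := ∑ k, a k * S i k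
  have key : ∀ ρ : ℝ, 0 < ρ → ρ ^ 2 < 1 → η * Q ≤ K * (ρ ^ 2 / (1 - ρ ^ 2)) := by
    intro ρ hρ h1
    have hσ : 0 < 1 - ρ ^ 2 := by linarith
    set Uf : ℝ → ℝ := fun ξ => ∫ t, columnAverage f a S i (ρ * ξ + √(1 - ρ ^ 2) * t)
      ∂(gaussianReal 0 1) with hUf
    set Ug : ℝ → ℝ := fun ξ => ∫ t, columnAverage g a S i (ρ * ξ + √(1 - ρ ^ 2) * t)
      ∂(gaussianReal 0 1) with hUg
    set m := gaussianAverage f a S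
    set mg := gaussianAverage g a S
    have mUf : HasMean _ Uf m := hasMean_mix_columnAverage hf hfa a S i h1
    have mUg : HasMean _ Ug mg := hasMean_mix_columnAverage hg hga a S i h1
    have hm01 : m ∈ Icc (0 : ℝ) 1 := gaussianAverage_mem_Icc hf hf01 a S
    have hUf' : ∀ ξ, gaussianAverage f (a + (ρ * ξ) • S i)
        (Function.update S i (√(1 - ρ ^ 2) • S i)) = Uf ξ := fun ξ =>
      gaussianAverage_update hf hfa a S i _ _
    have hUf01 : ∀ ξ, Uf ξ ∈ Icc (0 : ℝ) 1 := fun ξ => by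
      rw [← hUf']
      exact gaussianAverage_mem_Icc hf hf01 _ _
    have hsm := mehler_smoothing h1 (continuous_columnAverage hf hfa a S i).measurable
      (abs_columnAverage_le hfa a S i) (by rw [integral_columnAverage_mul hf hfa, hi])
    rw [← gaussianAverage_eq_integral_columnAverage hf hfa] at hsm
    have mV : HasMean (gaussianReal 0 1) (fun ξ => (Uf ξ - m) ^ 2)
        (∫ ξ, (Uf ξ - m) ^ 2 ∂(gaussianReal 0 1)) := by
      refine ⟨?_, rfl⟩
      refine Integrable.of_bound (C := 1)
        ((mUf.1.aestronglyMeasurable.sub aestronglyMeasurable_const).pow 2)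
        (ae_of_all _ fun ξ => ?_)
      have h0 := hUf01 ξ
      rw [Real.norm_eq_abs, abs_of_nonneg (sq_nonneg _), sq_le_one_iff_abs_le_one, abs_le]
      exact ⟨by linarith [h0.1, hm01.2], by linarith [h0.2, hm01.1]⟩
    have m1 : HasMean (gaussianReal 0 1) (fun ξ : ℝ => ξ) 0 :=
      ⟨memLp_two_stdGaussian_id.integrable (by norm_num), integral_stdGaussian_id⟩
    have m2 : HasMean (gaussianReal 0 1) (fun ξ : ℝ => ξ ^ 2) 1 :=
      ⟨memLp_two_stdGaussian_id.integrable_sq, integral_stdGaussian_sq⟩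
    have hpt : ∀ ξ, Ug ξ - L m * Uf ξ - K * (Uf ξ - m) ^ 2 - 2 * η * ρ * c * ξ -
        η * ρ ^ 2 * Q * ξ ^ 2 ≤ mg - L m * m - 2 * η * ρ ^ 2 * Q := by
      intro ξ
      have hJ := hmax (a + (ρ * ξ) • S i) (Function.update S i (√(1 - ρ ^ 2) • S i))
      rw [hUf', gaussianAverage_update hg hga, needlePenalty_update, Real.sq_sqrt hσ.le] at hJ
      have := hΘ m hm01 (Uf ξ) (hUf01 ξ)
      change Ug ξ - Θ (Uf ξ) - η * (needlePenalty a S + 2 * (ρ * ξ) * c +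
        ((ρ * ξ) ^ 2 + 2 * (1 - ρ ^ 2 - 1)) * Q) ≤ mg - Θ m - η * needlePenalty a S at hJ
      nlinarith
    have mm := ((((mUg.sub (mUf.const_mul (L m))).sub (mV.const_mul K)).sub
      (m1.const_mul (2 * η * ρ * c))).sub (m2.const_mul (η * ρ ^ 2 * Q)))
    have hint := integral_mono mm.1 (integrable_const _) hpt
    rw [mm.2] at hint
    simp only [integral_const, probReal_univ, one_smul] at hint
    have h2 : η * ρ ^ 2 * Q ≤ K * (ρ ^ 4 / (1 - ρ ^ 2)) := by
      have := mul_le_mul_of_nonneg_left hsm hK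
      linarith
    have h3 : ρ ^ 2 * (η * Q) ≤ ρ ^ 2 * (K * (ρ ^ 2 / (1 - ρ ^ 2))) := by
      calc ρ ^ 2 * (η * Q) = η * ρ ^ 2 * Q := by ring
        _ ≤ K * (ρ ^ 4 / (1 - ρ ^ 2)) := h2
        _ = _ := by ring
    exact le_of_mul_le_mul_left h3 (by positivity)
  have hlim : Tendsto (fun ρ : ℝ => K * (ρ ^ 2 / (1 - ρ ^ 2))) (𝓝[>] 0) (𝓝 0) := by
    have : ContinuousAt (fun ρ : ℝ => K * (ρ ^ 2 / (1 - ρ ^ 2))) 0 := by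
      refine ContinuousAt.mul (by fun_prop) (ContinuousAt.div (by fun_prop) (by fun_prop) ?_)
      norm_num
    have h := this.tendsto
    norm_num at h
    exact h.mono_left nhdsWithin_le_nhds
  have hle : η * Q ≤ 0 := by
    refine ge_of_tendsto hlim ?_
    filter_upwards [Ioo_mem_nhdsGT (zero_lt_one' ℝ)] with ρ hρ
    exact key ρ hρ.1 (by nlinarith [hρ.1, hρ.2])
  have hQz : Q = 0 := le_antisymm (by nlinarith) hQ0
  funext k
  have := (Finset.sum_eq_zero_iff_of_nonneg fun k _ => sq_nonneg (S i k)).1 hQz k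
    (Finset.mem_univ k)
  simpa using this

theorem isCompact_needlePenalty_le {n d : ℕ} (B : ℝ) :
    IsCompact {q : (Fin d → ℝ) × (Fin n → Fin d → ℝ) | needlePenalty q.1 q.2 ≤ B} := by
  refine Metric.isCompact_of_isClosed_isBounded ?_ ?_
  · refine isClosed_le ?_ continuous_const
    unfold needlePenalty
    fun_prop
  · refine (Metric.isBounded_closedBall (x := 0) (r := √B)).subset fun q hq => ?_
    have hq : needlePenalty q.1 q.2 ≤ B := hq
    unfold needlePenalty at hq
    have p1 : 0 ≤ ∑ k, q.1 k ^ 2 := Finset.sum_nonneg fun k _ => sq_nonneg _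
    have p2 : ∀ j, 0 ≤ ∑ k, q.2 j k ^ 2 := fun j => Finset.sum_nonneg fun k _ => sq_nonneg _
    have p3 : 0 ≤ ∑ j, ∑ k, q.2 j k ^ 2 := Finset.sum_nonneg fun j _ => p2 j
    rw [mem_closedBall_zero_iff, Prod.norm_def, max_le_iff]
    constructor
    · rw [pi_norm_le_iff_of_nonneg (Real.sqrt_nonneg _)]
      intro k
      refine Real.abs_le_sqrt ?_
      have := Finset.single_le_sum (fun k _ => sq_nonneg (q.1 k)) (Finset.mem_univ k)
      linarith
    · rw [pi_norm_le_iff_of_nonneg (Real.sqrt_nonneg _)]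
      intro j
      rw [pi_norm_le_iff_of_nonneg (Real.sqrt_nonneg _)]
      intro k
      refine Real.abs_le_sqrt ?_
      have := Finset.single_le_sum (fun k _ => sq_nonneg (q.2 j k)) (Finset.mem_univ k)
      have := Finset.single_le_sum (fun j _ => p2 j) (Finset.mem_univ j)
      linarith

/-- Gaussian localization: an inequality `∫ g ≤ Θ (∫ f)` that holds for every one-dimensional
Gaussian (degenerate ones included) holds for the standard Gaussian in any dimension. -/
theorem gaussian_needle {n : ℕ} {f g : (Fin (n + 1) → ℝ) → ℝ} (hf : Continuous f)
    (hg : Continuous g) (hf01 : ∀ x, f x ∈ Icc (0 : ℝ) 1) (hg01 : ∀ x, g x ∈ Icc (0 : ℝ) 1)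
    {Θ L : ℝ → ℝ} {K : ℝ} (hK : 0 ≤ K) (hΘc : Continuous Θ) (hΘ0 : ∀ x, 0 ≤ Θ x)
    (hΘ : ∀ x ∈ Icc (0 : ℝ) 1, ∀ y ∈ Icc (0 : ℝ) 1,
      Θ y ≤ Θ x + L x * (y - x) + K * (y - x) ^ 2)
    (H : ∀ a w : Fin (n + 1) → ℝ, ∫ t, g (a + t • w) ∂(gaussianReal 0 1) ≤
      Θ (∫ t, f (a + t • w) ∂(gaussianReal 0 1))) :
    ∫ z, g z ∂(stdGaussianPi (n + 1)) ≤ Θ (∫ z, f z ∂(stdGaussianPi (n + 1))) := by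
  classical
  by_contra! hlt
  have hfa := fun x => abs_le_one_of_mem_Icc (hf01 x)
  have hga := fun x => abs_le_one_of_mem_Icc (hg01 x)
  set S₀ : Fin (n + 1) → Fin (n + 1) → ℝ := fun j => Pi.single j 1
  have hS₀ : ∀ h : (Fin (n + 1) → ℝ) → ℝ,
      gaussianAverage h 0 S₀ = ∫ z, h z ∂(stdGaussianPi (n + 1)) := by
    intro h
    unfold gaussianAverage
    congr 1 with z
    congr 1
    rw [zero_add]
    exact (pi_eq_sum_univ' z).symm
  set c := needlePenalty (0 : Fin (n + 1) → ℝ) S₀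
  have hpen : ∀ (a : Fin (n + 1) → ℝ) (S : Fin (n + 1) → Fin (n + 1) → ℝ),
      0 ≤ needlePenalty a S := fun a S =>
    add_nonneg (Finset.sum_nonneg fun k _ => sq_nonneg _) (mul_nonneg zero_le_two
      (Finset.sum_nonneg fun j _ => Finset.sum_nonneg fun k _ => sq_nonneg _))
  have hc : 0 ≤ c := hpen 0 S₀
  set δ := ∫ z, g z ∂(stdGaussianPi (n + 1)) - Θ (∫ z, f z ∂(stdGaussianPi (n + 1))) with hδ
  have hδ0 : 0 < δ := sub_pos.2 hlt
  set η := δ / (c + 1)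
  have hη : 0 < η := by positivity
  set J : (Fin (n + 1) → ℝ) × (Fin (n + 1) → Fin (n + 1) → ℝ) → ℝ := fun q =>
    gaussianAverage g q.1 q.2 - Θ (gaussianAverage f q.1 q.2) - η * needlePenalty q.1 q.2 with hJ
  have hJc : Continuous J := by
    refine ((continuous_gaussianAverage hg hga).sub
      (hΘc.comp (continuous_gaussianAverage hf hfa))).sub (continuous_const.mul ?_)
    unfold needlePenalty
    fun_prop
  have hJ0 : 0 < J (0, S₀) := by
    simp only [hJ, hS₀]
    rw [← hδ, show needlePenalty (0 : Fin (n + 1) → ℝ) S₀ = c from rfl, sub_pos,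
      div_mul_eq_mul_div, div_lt_iff₀ (by positivity)]
    nlinarith
  have hJpos : ∀ q, 0 < J q → needlePenalty q.1 q.2 ≤ 1 / η := by
    intro q hq
    have h1 := (gaussianAverage_mem_Icc hg hg01 q.1 q.2).2
    have h2 := hΘ0 (gaussianAverage f q.1 q.2)
    rw [le_div_iff₀ hη]
    simp only [hJ] at hq
    linarith
  obtain ⟨⟨a, S⟩, haS, hmax⟩ := (isCompact_needlePenalty_le (1 / η)).exists_isMaxOn
    ⟨(0, S₀), hJpos _ hJ0⟩ hJc.continuousOn
  have hmax0 : 0 < J (a, S) := hJ0.trans_le (hmax (hJpos _ hJ0))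
  have hmax' : ∀ q, J q ≤ J (a, S) := by
    intro q
    by_cases hq : 0 < J q
    · exact hmax (hJpos q hq)
    · exact (not_lt.1 hq).trans hmax0.le
  obtain ⟨S', hS'1, hS'2, hS'3⟩ := exists_rotation hf hfa a S
  have hJS' : J (a, S') = J (a, S) := by
    simp only [hJ, hS'1, needlePenalty, hS'2]
  have hcol : ∀ i, i ≠ 0 → S' i = 0 := fun i hi =>
    column_eq_zero_of_isMax hf hg hf01 hg01 hK hη hΘ
      (fun b T => (hmax' (b, T)).trans hJS'.symm.le) (hS'3 i hi)
  have hline : ∀ h : (Fin (n + 1) → ℝ) → ℝ, Continuous h →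
      gaussianAverage h a S' = ∫ t, h (a + t • S' 0) ∂(gaussianReal 0 1) := by
    intro h hh
    have hsum : ∀ z : Fin (n + 1) → ℝ, ∑ j, z j • S' j = z 0 • S' 0 := fun z =>
      Finset.sum_eq_single 0 (fun j _ hj => by rw [hcol j hj, smul_zero]) (by simp)
    unfold gaussianAverage
    simp_rw [hsum]
    rw [← (measurePreserving_eval_stdGaussianPi (0 : Fin (n + 1))).map_eq,
      integral_map (measurable_pi_apply 0).aemeasurable
        (Continuous.aestronglyMeasurable (by fun_prop))]
  have hfin := H a (S' 0)
  rw [← hline g hg, ← hline f hf] at hfin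
  rw [← hJS'] at hmax0
  simp only [hJ] at hmax0
  nlinarith [mul_nonneg hη.le (hpen a S')]

/-- The exponential has the quadratic upper approximation required by `gaussian_needle`. -/
theorem exp_neg_quadratic_bound {A κ : ℝ} (hA : 0 ≤ A) (hκ : 0 ≤ κ) {x y : ℝ}
    (hx : x ∈ Icc (0 : ℝ) 1) (hy : y ∈ Icc (0 : ℝ) 1) :
    A * Real.exp (-(κ * y)) ≤ A * Real.exp (-(κ * x)) +
      -(A * κ * Real.exp (-(κ * x))) * (y - x) + A * κ ^ 2 * Real.exp κ * (y - x) ^ 2 := by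
  set w := κ * (x - y) with hw
  have hwκ : |w| ≤ κ := by
    rw [hw, abs_mul, abs_of_nonneg hκ]
    refine mul_le_of_le_one_right hκ (abs_le.2 ⟨?_, ?_⟩)
    · linarith [hx.1, hy.2]
    · linarith [hx.2, hy.1]
  have key : Real.exp w - 1 - w ≤ w ^ 2 * Real.exp κ := by
    have hE : 1 ≤ Real.exp κ := Real.one_le_exp hκ
    rcases le_total 0 w with h | h
    · have h1 : Real.exp w ≤ Real.exp κ := Real.exp_le_exp.2 ((le_abs_self w).trans hwκ)
      have h2 := Real.add_one_le_exp (-w)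
      have h3 : Real.exp w * Real.exp (-w) = 1 := by rw [← Real.exp_add]; simp
      have h4 : Real.exp w - 1 ≤ w * Real.exp w := by
        nlinarith [Real.exp_pos w]
      have h5 : Real.exp w - 1 ≤ w * Real.exp κ := h4.trans (mul_le_mul_of_nonneg_left h1 h)
      have h6 : w * (Real.exp w - 1) ≤ w * (w * Real.exp κ) := mul_le_mul_of_nonneg_left h5 h
      nlinarith
    · have h1 := Real.add_one_le_exp w
      have h2 := Real.add_one_le_exp (-w)
      have h3 : Real.exp w * Real.exp (-w) = 1 := by rw [← Real.exp_add]; simp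
      have h4 : Real.exp w - 1 ≤ w * Real.exp w := by
        nlinarith [Real.exp_pos w]
      have h6 : w * Real.exp w ≤ w * (w + 1) := mul_le_mul_of_nonpos_left h1 h
      nlinarith [sq_nonneg w]
  have e1 : Real.exp (-(κ * y)) = Real.exp (-(κ * x)) * Real.exp w := by
    rw [← Real.exp_add, hw]; congr 1; ring
  have e2 : Real.exp (-(κ * x)) ≤ 1 := by
    rw [Real.exp_le_one_iff]
    have := mul_nonneg hκ hx.1
    linarith
  have e3 : Real.exp (-(κ * x)) * (Real.exp w - 1 - w) ≤ w ^ 2 * Real.exp κ := by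
    refine (mul_le_mul_of_nonneg_left key (Real.exp_pos _).le).trans ?_
    exact mul_le_of_le_one_left (by positivity) e2
  have e4 := mul_le_mul_of_nonneg_left e3 hA
  rw [e1]
  have e5 : w ^ 2 = κ ^ 2 * (y - x) ^ 2 := by rw [hw]; ring
  rw [e5] at e4
  have e6 : A * (Real.exp (-(κ * x)) * (Real.exp w - 1 - w)) =
    A * (Real.exp (-(κ * x)) * Real.exp w) - A * Real.exp (-(κ * x)) +
      A * κ * Real.exp (-(κ * x)) * (y - x) := by rw [hw]; ring
  rw [e6] at e4
  linarith

theorem gaussianReal_real_eq_integral (s : Set ℝ) :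
    (gaussianReal 0 1).real s = ∫ x in s, gaussianPDFReal 0 1 x := by
  rw [measureReal_def, gaussianReal_apply_eq_integral 0 one_ne_zero, ENNReal.toReal_ofReal]
  exact integral_nonneg fun x => gaussianPDFReal_nonneg 0 1 x

theorem one_add_abs_mul_gaussianPDFReal_le (t : ℝ) : (1 + |t|) * gaussianPDFReal 0 1 t ≤ 1 := by
  have h1 := Real.add_one_le_exp (t ^ 2 / 2)
  have h2 : 2 ≤ √(2 * Real.pi) := by
    rw [Real.le_sqrt (by norm_num) (by positivity)]
    nlinarith [Real.pi_gt_three]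
  have h3 : gaussianPDFReal 0 1 t = (√(2 * Real.pi) * Real.exp (t ^ 2 / 2))⁻¹ := by
    simp only [gaussianPDFReal, NNReal.coe_one, mul_one, sub_zero]
    rw [mul_inv, ← Real.exp_neg, neg_div]
  rw [h3, ← div_eq_mul_inv, div_le_one (by positivity)]
  have h4 : 2 * Real.exp (t ^ 2 / 2) ≤ √(2 * Real.pi) * Real.exp (t ^ 2 / 2) :=
    mul_le_mul_of_nonneg_right h2 (Real.exp_pos _).le
  nlinarith [sq_abs t, sq_nonneg (|t| - 1)]

/-- Gaussian intervals far from the origin are long compared to their mass. -/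
theorem one_add_abs_mul_gaussianReal_Ioc_le {u w z : ℝ} (huw : u ≤ w) (hz : z ∈ Icc u w) :
    (1 + |z|) * (gaussianReal 0 1).real (Ioc u w) ≤ 2 * (w - u) := by
  have hi : IntegrableOn (gaussianPDFReal 0 1) (Ioc u w) :=
    (integrable_gaussianPDFReal 0 1).integrableOn
  have hone : Integrable (fun _ => (1 : ℝ)) (volume.restrict (Ioc u w)) := integrable_const _
  have h1 : ∫ t in Ioc u w, (1 + |z|) * gaussianPDFReal 0 1 t ≤
      ∫ t in Ioc u w, (1 + (w - u) * gaussianPDFReal 0 1 t) := by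
    refine setIntegral_mono_on (hi.const_mul _)
      (hone.add (hi.const_mul _)) measurableSet_Ioc fun t ht => ?_
    have h2 := one_add_abs_mul_gaussianPDFReal_le t
    have h3 := gaussianPDFReal_nonneg 0 1 t
    have h4 : |z| ≤ |t| + (w - u) := by
      have h5 : |z - t| ≤ w - u := abs_le.2 ⟨by linarith [hz.1, ht.2], by linarith [hz.2, ht.1]⟩
      have h6 := abs_sub_abs_le_abs_sub z t
      linarith
    nlinarith
  rw [integral_const_mul, integral_add hone (hi.const_mul _),
    integral_const_mul, ← gaussianReal_real_eq_integral] at h1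
  have h2 : (gaussianReal 0 1).real (Ioc u w) ≤ 1 := measureReal_le_one
  have h3 : ∫ _ in Ioc u w, (1 : ℝ) = w - u := by simp [huw]
  rw [h3] at h1
  nlinarith

theorem exists_gaussianReal_inter_Iic_eq {D : Set ℝ} {c : ℝ} (hc0 : 0 < c)
    (hc : c < (gaussianReal 0 1).real D) :
    ∃ y, (gaussianReal 0 1).real (D ∩ Iic y) = c := by
  set γ := gaussianReal 0 1 with hγ
  have hmono : ∀ x y, γ.real (D ∩ Iic x) ≤ γ.real (D ∩ Iic y) + 2 * dist x y := by
    intro x y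
    have h1 : D ∩ Iic x ⊆ (D ∩ Iic y) ∪ Ioc y x := fun t ht => by
      by_cases h : t ≤ y
      · exact Or.inl ⟨ht.1, h⟩
      · exact Or.inr ⟨not_le.1 h, ht.2⟩
    have h2 : γ.real (Ioc y x) ≤ 2 * dist x y := by
      rcases le_total y x with h | h
      · have h3 := one_add_abs_mul_gaussianReal_Ioc_le h (left_mem_Icc.2 h)
        rw [Real.dist_eq, abs_of_nonneg (sub_nonneg.2 h)]
        nlinarith [abs_nonneg y, measureReal_nonneg (μ := γ) (s := Ioc y x)]
      · rw [Ioc_eq_empty (not_lt.2 h)]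
        simp
    calc γ.real (D ∩ Iic x) ≤ γ.real ((D ∩ Iic y) ∪ Ioc y x) := measureReal_mono h1
      _ ≤ γ.real (D ∩ Iic y) + γ.real (Ioc y x) := measureReal_union_le _ _
      _ ≤ _ := by linarith
  have hcont : Continuous fun y => γ.real (D ∩ Iic y) :=
    (LipschitzWith.of_le_add_mul 2 hmono).continuous
  refine mem_range_of_exists_le_of_exists_ge hcont ?_ ?_
  · obtain ⟨y, hy⟩ := ((tendsto_cdf_atBot γ).eventually (gt_mem_nhds hc0)).exists
    refine ⟨y, le_trans ?_ hy.le⟩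
    rw [cdf_eq_real]
    exact measureReal_mono inter_subset_right
  · obtain ⟨y, hy⟩ := ((tendsto_cdf_atTop γ).eventually
      (lt_mem_nhds (show 1 - (γ.real D - c) < 1 by linarith))).exists
    refine ⟨y, ?_⟩
    rw [cdf_eq_real] at hy
    have h1 : γ.real D ≤ γ.real (D ∩ Iic y) + γ.real (Iic y)ᶜ := by
      refine (measureReal_mono (fun t ht => ?_)).trans (measureReal_union_le _ _)
      by_cases h : t ∈ Iic y
      · exact Or.inl ⟨ht, h⟩
      · exact Or.inr h
    rw [probReal_compl_eq_one_sub measurableSet_Iic] at h1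
    linarith

/-- Inside a set of mass `γ(D)` one can pick `m + 1` points with well separated quantiles. -/
theorem exists_separated_points {D : Set ℝ}
    (hpos : 0 < (gaussianReal 0 1).real D) (m : ℕ) :
    ∃ x : ℕ → ℝ, ∀ i ≤ m, x i ∈ D ∧ ∀ j ≤ m, i < j → x i < x j ∧
      ((j : ℝ) - i) * ((gaussianReal 0 1).real D / (2 * m + 3)) ≤
        (gaussianReal 0 1).real (Ioc (x i) (x j)) := by
  set γ := gaussianReal 0 1 with hγ
  set δ := γ.real D / (2 * m + 3) with hδ
  have hδ0 : 0 < δ := by positivity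
  have hδD : γ.real D = δ * (2 * m + 3) := by rw [hδ]; field_simp
  have hex : ∀ k : ℕ, ∃ y, k ≤ 2 * m + 1 → γ.real (D ∩ Iic y) = (k + 1) * δ := by
    intro k
    by_cases hk : k ≤ 2 * m + 1
    · have hk' : (k : ℝ) ≤ 2 * m + 1 := by exact_mod_cast hk
      obtain ⟨y, hy⟩ := exists_gaussianReal_inter_Iic_eq (D := D)
        (c := (k + 1) * δ) (by positivity) (by rw [← hγ, hδD]; nlinarith)
      exact ⟨y, fun _ => hy⟩
    · exact ⟨0, fun h => absurd h hk⟩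
  choose y hy using hex
  have hlt : ∀ k l, k ≤ 2 * m + 1 → l ≤ 2 * m + 1 → k < l → y k < y l := by
    intro k l hk hl hkl
    by_contra! h
    have h1 : γ.real (D ∩ Iic (y l)) ≤ γ.real (D ∩ Iic (y k)) :=
      measureReal_mono (inter_subset_inter_right _ (Iic_subset_Iic.2 h))
    rw [hy k hk, hy l hl] at h1
    have : (k : ℝ) < l := by exact_mod_cast hkl
    nlinarith
  have hdiff : ∀ k l, k ≤ 2 * m + 1 → l ≤ 2 * m + 1 →
      ((l : ℝ) - k) * δ ≤ γ.real (D ∩ Ioc (y k) (y l)) := by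
    intro k l hk hl
    have h1 : γ.real (D ∩ Iic (y l)) ≤ γ.real (D ∩ Iic (y k)) + γ.real (D ∩ Ioc (y k) (y l)) := by
      refine (measureReal_mono (fun t ht => ?_)).trans (measureReal_union_le _ _)
      by_cases h : t ≤ y k
      · exact Or.inl ⟨ht.1, h⟩
      · exact Or.inr ⟨ht.1, not_le.1 h, ht.2⟩
    rw [hy k hk, hy l hl] at h1
    linarith
  have hpt : ∀ i, ∃ x, i ≤ m → x ∈ D ∩ Ioc (y (2 * i)) (y (2 * i + 1)) := by
    intro i
    by_cases hi : i ≤ m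
    · have h1 := hdiff (2 * i) (2 * i + 1) (by omega) (by omega)
      have h2 : (D ∩ Ioc (y (2 * i)) (y (2 * i + 1))).Nonempty := by
        by_contra! h
        rw [h] at h1
        push_cast at h1
        simp at h1
        linarith
      exact ⟨h2.some, fun _ => h2.some_mem⟩
    · exact ⟨0, fun h => absurd h hi⟩
  choose x hx using hpt
  refine ⟨x, fun i hi => ⟨(hx i hi).1, fun j hj hij => ?_⟩⟩
  have h1 := (hx i hi).2.2
  have h2 := (hx j hj).2.1
  have h3 := hlt (2 * i + 1) (2 * j) (by omega) (by omega) (by omega)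
  refine ⟨by linarith, ?_⟩
  have h4 := hdiff (2 * i + 1) (2 * j) (by omega) (by omega)
  have h5 : γ.real (D ∩ Ioc (y (2 * i + 1)) (y (2 * j))) ≤ γ.real (Ioc (x i) (x j)) :=
    measureReal_mono (inter_subset_right.trans (Ioc_subset_Ioc h1 h2.le))
  have h6 : (i : ℝ) + 1 ≤ j := by exact_mod_cast hij
  push_cast at h4
  nlinarith

theorem prod_range_erase_abs_sub {i m : ℕ} (him : i ≤ m) :
    ∏ j ∈ (Finset.range (m + 1)).erase i, |(i : ℝ) - j| =
      (i.factorial : ℝ) * ((m - i).factorial : ℝ) := by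
  induction m, him using Nat.le_induction with
  | base =>
    have h1 : (Finset.range (i + 1)).erase i = Finset.range i := by
      rw [Finset.range_add_one, Finset.erase_insert (by simp)]
    rw [h1, Nat.sub_self, Nat.factorial_zero, Nat.cast_one, mul_one, ← Nat.descFactorial_self,
      Nat.descFactorial_eq_prod_range, Nat.cast_prod]
    refine Finset.prod_congr rfl fun j hj => ?_
    have hj' : j ≤ i := (Finset.mem_range.1 hj).le
    rw [Nat.cast_sub hj', abs_of_nonneg]
    have : (j : ℝ) ≤ i := by exact_mod_cast hj'
    linarith
  | succ m him ih =>
    have h1 : (Finset.range (m + 1 + 1)).erase i =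
        insert (m + 1) ((Finset.range (m + 1)).erase i) := by
      rw [Finset.range_add_one (n := m + 1), Finset.erase_insert_of_ne (by omega)]
    rw [h1, Finset.prod_insert (by simp), ih, Nat.succ_sub him, Nat.factorial_succ]
    have : (i : ℝ) ≤ m := by exact_mod_cast him
    push_cast [Nat.cast_sub him]
    rw [abs_of_nonpos (by linarith)]
    ring

theorem sum_range_inv_factorial_mul (m : ℕ) :
    ∑ i ∈ Finset.range (m + 1), ((i.factorial : ℝ) * ((m - i).factorial : ℝ))⁻¹ =
      2 ^ m / m.factorial := by
  rw [eq_div_iff (by positivity), Finset.sum_mul]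
  have h := congrArg (Nat.cast : ℕ → ℝ) (Nat.sum_range_choose m)
  push_cast at h
  rw [← h]
  refine Finset.sum_congr rfl fun i hi => ?_
  rw [Nat.cast_choose ℝ (Nat.lt_succ_iff.1 (Finset.mem_range.1 hi))]
  field_simp

theorem abs_eval_le_of_nodes {g : Polynomial ℝ} {m : ℕ} (hg : g.natDegree ≤ m) {x : ℕ → ℝ}
    {ε R t : ℝ} (hε : 0 ≤ ε) (hinj : InjOn x (Finset.range (m + 1)))
    (hx : ∀ i ≤ m, |g.eval (x i)| ≤ ε)
    (hR' : ∀ i ≤ m, ∀ j ≤ m, i ≠ j → |t - x j| * |(i : ℝ) - j| ≤ R * |x i - x j|) :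
    |g.eval t| ≤ ε * (R ^ m * (2 ^ m / m.factorial)) := by
  have hdeg : g.degree < (Finset.range (m + 1)).card := by
    rw [Finset.card_range]
    exact Polynomial.degree_lt_iff_coeff_zero _ _ |>.2 fun k hk =>
      Polynomial.coeff_eq_zero_of_natDegree_lt (by omega)
  have h1 : g.eval t = ∑ i ∈ Finset.range (m + 1), g.eval (x i) *
      ∏ j ∈ (Finset.range (m + 1)).erase i, ((x i - x j)⁻¹ * (t - x j)) := by
    conv_lhs => rw [Lagrange.eq_interpolate hinj hdeg]
    simp [Lagrange.interpolate_apply, Polynomial.eval_finsetSum, Lagrange.basis,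
      Polynomial.eval_prod, Lagrange.basisDivisor]
  rw [h1, ← sum_range_inv_factorial_mul, Finset.mul_sum, Finset.mul_sum]
  refine (Finset.abs_sum_le_sum_abs _ _).trans (Finset.sum_le_sum fun i hi => ?_)
  have him : i ≤ m := Nat.lt_succ_iff.1 (Finset.mem_range.1 hi)
  rw [abs_mul, Finset.abs_prod]
  refine mul_le_mul (hx i him) ?_ (Finset.prod_nonneg fun _ _ => abs_nonneg _) hε
  have hcard : ((Finset.range (m + 1)).erase i).card = m := by
    rw [Finset.card_erase_of_mem hi, Finset.card_range, Nat.add_sub_cancel]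
  rw [← prod_range_erase_abs_sub him, ← Finset.prod_inv_distrib]
  nth_rewrite 2 [← hcard]
  rw [← Finset.prod_const, ← Finset.prod_mul_distrib]
  refine Finset.prod_le_prod (fun _ _ => abs_nonneg _) fun j hj => ?_
  have hjm : j ≤ m := Nat.lt_succ_iff.1 (Finset.mem_range.1 (Finset.mem_of_mem_erase hj))
  have hji : i ≠ j := (Finset.ne_of_mem_erase hj).symm
  have hpos1 : 0 < |(i : ℝ) - j| := abs_pos.2 (sub_ne_zero.2 (by exact_mod_cast hji))
  have hpos2 : 0 < |x i - x j| := abs_pos.2 (sub_ne_zero.2 fun h => hji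
    (hinj hi (Finset.mem_of_mem_erase hj) h))
  have := hR' i him j hjm hji
  rw [abs_mul, abs_inv, ← div_eq_inv_mul, ← div_eq_mul_inv, div_le_div_iff₀ hpos2 hpos1]
  exact this

/-- A Remez-type inequality for the Gaussian measure on the line. -/
theorem abs_eval_le_of_gaussianReal_pos {g : Polynomial ℝ} {m : ℕ} (hm : 0 < m)
    (hg : g.natDegree ≤ m) {ε : ℝ} (hε : 0 ≤ ε)
    (hpos : 0 < (gaussianReal 0 1).real {s | |g.eval s| ≤ ε}) (t : ℝ) :
    |g.eval t| ≤ ε * (60 * (1 + |t|) / (gaussianReal 0 1).real {s | |g.eval s| ≤ ε}) ^ m := by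
  obtain ⟨x, hx⟩ := exists_separated_points hpos m
  set F := (gaussianReal 0 1).real {s | |g.eval s| ≤ ε} with hF
  have hm' : (1 : ℝ) ≤ m := by exact_mod_cast hm
  have hN : (0 : ℝ) < 2 * m + 3 := by positivity
  set Q := 20 * (1 + |t|) / F with hQ
  have hQ0 : 0 ≤ Q := by positivity
  have hsep : ∀ i ≤ m, ∀ j ≤ m, i < j → ∀ z ∈ Icc (x i) (x j),
      (1 + |z|) * (((j : ℝ) - i) * (F / (2 * m + 3))) ≤ 2 * (x j - x i) := by
    intro i hi j hj hij z hz
    obtain ⟨h1, h2⟩ := (hx i hi).2 j hj hij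
    exact (mul_le_mul_of_nonneg_left h2 (by positivity)).trans
      (one_add_abs_mul_gaussianReal_Ioc_le h1.le hz)
  have hsep' : ∀ i ≤ m, ∀ j ≤ m, i ≠ j →
      (1 + |x j|) * (|(i : ℝ) - j| * (F / (2 * m + 3))) ≤ 2 * |x i - x j| := by
    intro i hi j hj hij
    rcases lt_or_gt_of_ne hij with h | h
    · have h1 := ((hx i hi).2 j hj h).1
      have h2 : (i : ℝ) < j := by exact_mod_cast h
      have := hsep i hi j hj h (x j) (right_mem_Icc.2 h1.le)
      rw [abs_sub_comm (i : ℝ), abs_sub_comm (x i), abs_of_pos (sub_pos.2 h1),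
        abs_of_pos (sub_pos.2 h2)]
      exact this
    · have h1 := ((hx j hj).2 i hi h).1
      have h2 : (j : ℝ) < i := by exact_mod_cast h
      have := hsep j hj i hi h (x j) (left_mem_Icc.2 h1.le)
      rw [abs_of_pos (sub_pos.2 h1), abs_of_pos (sub_pos.2 h2)]
      exact this
  have hinj : InjOn x (Finset.range (m + 1)) := by
    intro i hi j hj hij
    have hi' : i ≤ m := Nat.lt_succ_iff.1 (Finset.mem_range.1 hi)
    have hj' : j ≤ m := Nat.lt_succ_iff.1 (Finset.mem_range.1 hj)
    by_contra hne
    rcases lt_or_gt_of_ne hne with h | h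
    · exact ((hx i hi').2 j hj' h).1.ne hij
    · exact ((hx j hj').2 i hi' h).1.ne hij.symm
  have hmain := abs_eval_le_of_nodes (t := t) (R := m * Q / 2) hg hε hinj
    (fun i hi => (hx i hi).1) fun i hi j hj hij => by
      have h1 := hsep' i hi j hj hij
      have h2 : |t - x j| ≤ (1 + |t|) * (1 + |x j|) := by
        have := abs_sub t (x j)
        nlinarith [abs_nonneg t, abs_nonneg (x j)]
      have h3 : (1 + |x j|) * |(i : ℝ) - j| ≤ 2 * |x i - x j| * ((2 * m + 3) / F) := by
        rw [← div_le_iff₀ (by positivity)]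
        calc _ = (1 + |x j|) * (|(i : ℝ) - j| * (F / (2 * m + 3))) := by field_simp
          _ ≤ _ := h1
      have h4 : (2 * (m : ℝ) + 3) / F ≤ 5 * m / F := by gcongr; linarith
      calc |t - x j| * |(i : ℝ) - j| ≤ (1 + |t|) * (1 + |x j|) * |(i : ℝ) - j| := by gcongr
        _ = (1 + |t|) * ((1 + |x j|) * |(i : ℝ) - j|) := by ring
        _ ≤ (1 + |t|) * (2 * |x i - x j| * ((2 * m + 3) / F)) := by gcongr
        _ ≤ (1 + |t|) * (2 * |x i - x j| * (5 * m / F)) := by gcongr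
        _ = m * Q / 2 * |x i - x j| := by rw [hQ]; ring
  refine hmain.trans (mul_le_mul_of_nonneg_left ?_ hε)
  have h1 := Real.pow_div_factorial_le_exp (m : ℝ) (by positivity) m
  have h2 : Real.exp m ≤ 3 ^ m := by
    rw [← mul_one (m : ℝ), Real.exp_nat_mul]
    exact pow_le_pow_left₀ (Real.exp_pos _).le Real.exp_one_lt_three.le m
  calc (m * Q / 2) ^ m * (2 ^ m / m.factorial) = Q ^ m * ((m : ℝ) ^ m / m.factorial) := by
        rw [div_pow, mul_pow]; field_simp
    _ ≤ Q ^ m * 3 ^ m := by gcongr; exact h1.trans h2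
    _ = (60 * (1 + |t|) / F) ^ m := by rw [← mul_pow, hQ]; ring

theorem gaussianReal_one_add_abs_ge_le (c : ℝ) :
    (gaussianReal 0 1).real {t | c ≤ 1 + |t|} ≤ 2 * Real.exp (3 / 2) * Real.exp (-c) := by
  obtain ⟨i1, e1⟩ := gaussianReal_quadratic (c := 0) (by norm_num) 1
  obtain ⟨i2, e2⟩ := gaussianReal_quadratic (c := 0) (by norm_num) (-1)
  have mm := ((show HasMean _ _ _ from ⟨i1, e1⟩).add (show HasMean _ _ _ from ⟨i2, e2⟩)).const_mul
    (Real.exp (1 - c))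
  have h := mul_meas_ge_le_integral_of_nonneg (μ := gaussianReal 0 1) (ae_of_all _ fun t => by
    positivity) mm.1 1
  rw [mm.2, one_mul] at h
  refine (measureReal_mono (fun t ht => ?_)).trans (h.trans (le_of_eq ?_))
  · have ht : c ≤ 1 + |t| := ht
    have h1 : Real.exp |t| ≤ Real.exp t + Real.exp (-t) := by
      rcases abs_cases t with h | h <;> rw [h.1] <;> linarith [Real.exp_pos t, Real.exp_pos (-t)]
    have h2 : 1 ≤ Real.exp (1 - c) * Real.exp |t| := by
      rw [← Real.exp_add]
      exact Real.one_le_exp (by linarith)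
    have h3 := mul_le_mul_of_nonneg_left h1 (Real.exp_pos (1 - c)).le
    simp only [mem_ofPred_eq, zero_mul, zero_add, one_mul, neg_mul]
    linarith
  · norm_num
    rw [show (3 / 2 : ℝ) = 1 / 2 + 1 by norm_num, sub_eq_add_neg, Real.exp_add, Real.exp_add]
    ring

/-- The one-dimensional distributional inequality. -/
theorem gaussianReal_polynomial_tail {g : Polynomial ℝ} {m : ℕ} (hm : 0 < m)
    (hg : g.natDegree ≤ m) {ε M : ℝ} (hε : 0 < ε) (hM : 0 < M) :
    (gaussianReal 0 1).real {s | M ≤ |g.eval s|} ≤ 2 * Real.exp (3 / 2) *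
      Real.exp (-((M / ε) ^ ((1 : ℝ) / m) / 60 *
        (gaussianReal 0 1).real {s | |g.eval s| ≤ ε})) := by
  set F := (gaussianReal 0 1).real {s | |g.eval s| ≤ ε} with hF
  rcases (measureReal_nonneg : 0 ≤ F).eq_or_lt with h0 | hpos
  · rw [show F = 0 from h0.symm, mul_zero, neg_zero, Real.exp_zero, mul_one]
    have := Real.one_le_exp (show (0 : ℝ) ≤ 3 / 2 by norm_num)
    exact measureReal_le_one.trans (by linarith)
  · refine (measureReal_mono fun s hs => ?_).trans (gaussianReal_one_add_abs_ge_le _)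
    have hs : M ≤ |g.eval s| := hs
    have h1 := hs.trans (abs_eval_le_of_gaussianReal_pos hm hg hε.le hpos s)
    rw [← div_le_iff₀' hε] at h1
    have h2 := Real.rpow_le_rpow (by positivity) h1 (show 0 ≤ (1 : ℝ) / m by positivity)
    rw [← hF, one_div, Real.pow_rpow_inv_natCast (by positivity) hm.ne', le_div_iff₀ hpos] at h2
    simp only [mem_ofPred_eq]
    rw [one_div]
    linarith

/-- The second moment of a random variable with stretched exponential tails. -/
theorem integral_sq_le_of_tail {Ω : Type*} [MeasurableSpace Ω] {μ : Measure Ω}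
    [IsProbabilityMeasure μ] {q : Ω → ℝ} (hq : Measurable q) {A b : ℝ} (hA : 0 ≤ A) (hb : 0 < b)
    {m : ℕ} (hm : 0 < m)
    (h : ∀ M, 0 < M → μ.real {x | M ≤ |q x|} ≤ A * Real.exp (-(b * M ^ ((1 : ℝ) / m)))) :
    ∫ x, q x ^ 2 ∂μ ≤ A * (2 * m).factorial / b ^ (2 * m) := by
  have hm0 : (0 : ℝ) < 1 / m := by positivity
  have hint : IntegrableOn (fun M : ℝ => A * (M ^ (1 : ℝ) * Real.exp (-b * M ^ ((1 : ℝ) / m))))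
      (Ioi 0) :=
    (integrableOn_rpow_mul_exp_neg_mul_rpow (by norm_num) hm0 hb).const_mul A
  have hval : ∫ M in Ioi (0 : ℝ), A * (M ^ (1 : ℝ) * Real.exp (-b * M ^ ((1 : ℝ) / m))) =
      A * (2 * m).factorial / b ^ (2 * m) / 2 := by
    rw [integral_const_mul, integral_rpow_mul_exp_neg_mul_rpow hm0 (by norm_num) hb]
    have e1 : ((1 : ℝ) + 1) / (1 / m) = ((2 * m - 1 : ℕ) : ℝ) + 1 := by
      rw [Nat.cast_sub (by omega)]; push_cast; field_simp; ring
    have e2 : -((1 : ℝ) + 1) / (1 / m) = -((2 * m : ℕ) : ℝ) := by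
      push_cast; field_simp; ring
    have e3 : (2 * m).factorial = 2 * m * (2 * m - 1).factorial :=
      (Nat.mul_factorial_pred (by omega)).symm
    rw [e1, e2, Real.Gamma_nat_eq_factorial, Real.rpow_neg hb.le, Real.rpow_natCast, e3]
    push_cast
    field_simp
  have hnn : ∀ M ∈ Ioi (0 : ℝ), 0 ≤ A * (M ^ (1 : ℝ) * Real.exp (-b * M ^ ((1 : ℝ) / m))) := by
    intro M hM
    have : (0 : ℝ) < M := hM
    positivity
  have hlay := lintegral_rpow_eq_lintegral_meas_le_mul μ (f := fun x => |q x|)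
    (ae_of_all _ fun x => abs_nonneg _) hq.abs.aemeasurable (p := 2) two_pos
  have hle : ∫⁻ x, ENNReal.ofReal (|q x| ^ (2 : ℝ)) ∂μ ≤
      ENNReal.ofReal (A * (2 * m).factorial / b ^ (2 * m)) := by
    rw [hlay]
    calc _ ≤ ENNReal.ofReal 2 * ∫⁻ M in Ioi (0 : ℝ),
          ENNReal.ofReal (A * (M ^ (1 : ℝ) * Real.exp (-b * M ^ ((1 : ℝ) / m)))) := by
          refine mul_le_mul' le_rfl (setLIntegral_mono' measurableSet_Ioi fun M hM => ?_)
          have hM : (0 : ℝ) < M := hM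
          rw [← ofReal_measureReal, ← ENNReal.ofReal_mul measureReal_nonneg]
          refine ENNReal.ofReal_le_ofReal ?_
          calc _ ≤ A * Real.exp (-(b * M ^ ((1 : ℝ) / m))) * M ^ ((2 : ℝ) - 1) := by
                gcongr; exact h M hM
            _ = _ := by norm_num; ring
      _ = ENNReal.ofReal (A * (2 * m).factorial / b ^ (2 * m)) := by
          rw [← ofReal_integral_eq_lintegral_ofReal hint
            ((ae_restrict_iff' measurableSet_Ioi).2 (ae_of_all _ hnn)), hval,
            ← ENNReal.ofReal_mul two_pos.le]
          congr 1
          ring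
  rw [integral_eq_lintegral_of_nonneg_ae (ae_of_all _ fun x => sq_nonneg _)
    (hq.pow_const 2).aestronglyMeasurable]
  refine ENNReal.toReal_le_of_le_ofReal (by positivity) (le_trans (le_of_eq ?_) hle)
  refine lintegral_congr fun x => ?_
  rw [Real.rpow_two, sq_abs]

theorem le_of_pow_le_mul_factorial {A b : ℝ} {m : ℕ} (hm : 0 < m) (hA : 1 ≤ A)
    (h : b ^ (2 * m) ≤ A * (2 * m).factorial) : b ≤ A * (2 * m) := by
  refine le_of_pow_le_pow_left₀ (n := 2 * m) (by omega) (by positivity) (h.trans ?_)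
  rw [mul_pow]
  gcongr
  · exact le_self_pow₀ hA (by omega)
  · exact_mod_cast Nat.factorial_le_pow (2 * m)

/-- The restriction of a polynomial to a line is a univariate polynomial. -/
theorem exists_polynomial_eval_add_smul {n m : ℕ} {p : MvPolynomial (Fin n) ℝ}
    (hp : p.totalDegree ≤ m) (a w : Fin n → ℝ) :
    ∃ g : Polynomial ℝ, g.natDegree ≤ m ∧ ∀ t, g.eval t = MvPolynomial.eval (a + t • w) p := by
  refine ⟨MvPolynomial.aeval (fun i => Polynomial.C (a i) + Polynomial.X * Polynomial.C (w i)) p,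
    ?_, fun t => ?_⟩
  · refine (MvPolynomial.aeval_natDegree_le p hp _ (n := 1) fun i => ?_).trans (by simp)
    compute_degree
  · rw [MvPolynomial.aeval_def, ← Polynomial.coe_evalRingHom, MvPolynomial.hom_eval₂]
    rw [MvPolynomial.eval, MvPolynomial.coe_eval₂Hom]
    congr 1
    · ext x; simp
    · ext i
      simp only [Polynomial.coe_evalRingHom, Polynomial.eval_add, Polynomial.eval_mul,
        Polynomial.eval_C, Polynomial.eval_X, Pi.add_apply, Pi.smul_apply, smul_eq_mul]

/-- A continuous cutoff equal to `1` on `Iic 1` and to `0` on `Ici 2`. -/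
noncomputable def cutoff (s : ℝ) : ℝ := max 0 (min 1 (2 - s))

theorem continuous_cutoff : Continuous cutoff := by
  unfold cutoff; fun_prop

theorem cutoff_mem_Icc (s : ℝ) : cutoff s ∈ Icc (0 : ℝ) 1 :=
  ⟨le_max_left _ _, max_le zero_le_one (min_le_left _ _)⟩

theorem cutoff_of_le_one {s : ℝ} (hs : s ≤ 1) : cutoff s = 1 := by
  rw [cutoff, min_eq_left (by linarith), max_eq_right zero_le_one]

theorem cutoff_of_two_le {s : ℝ} (hs : 2 ≤ s) : cutoff s = 0 := by
  rw [cutoff, max_eq_left]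
  exact (min_le_right _ _).trans (by linarith)

theorem integral_le_measureReal {Ω : Type*} [MeasurableSpace Ω] {μ : Measure Ω}
    [IsProbabilityMeasure μ] {f : Ω → ℝ} (hfm : Measurable f) (hf : ∀ x, f x ∈ Icc (0 : ℝ) 1)
    {s : Set Ω} (hs : MeasurableSet s) (h : ∀ x ∉ s, f x = 0) : ∫ x, f x ∂μ ≤ μ.real s := by
  rw [← integral_indicator_one hs]
  refine integral_mono (Integrable.of_mem_Icc 0 1 hfm.aemeasurable (ae_of_all _ hf))
    ((integrable_const _).indicator hs) fun x => ?_
  by_cases hx : x ∈ s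
  · simpa [hx] using (hf x).2
  · simp [hx, h x hx]

theorem measureReal_le_integral {Ω : Type*} [MeasurableSpace Ω] {μ : Measure Ω}
    [IsProbabilityMeasure μ] {f : Ω → ℝ} (hfm : Measurable f) (hf : ∀ x, f x ∈ Icc (0 : ℝ) 1)
    {s : Set Ω} (hs : MeasurableSet s) (h : ∀ x ∈ s, f x = 1) : μ.real s ≤ ∫ x, f x ∂μ := by
  rw [← integral_indicator_one hs]
  refine integral_mono ((integrable_const _).indicator hs)
    (Integrable.of_mem_Icc 0 1 hfm.aemeasurable (ae_of_all _ hf)) fun x => ?_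
  by_cases hx : x ∈ s
  · simp [hx, h x hx]
  · simpa [hx] using (hf x).1

/-- The one-dimensional distributional inequality transfers to every dimension. -/
theorem stdGaussianPi_polynomial_tail {n m : ℕ} (hm : 0 < m) {q : MvPolynomial (Fin (n + 1)) ℝ}
    (hq : q.totalDegree ≤ m) {ε M : ℝ} (hε : 0 < ε) (hM : 0 < M) :
    (stdGaussianPi (n + 1)).real {x | M ≤ |MvPolynomial.eval x q|} ≤ 2 * Real.exp (3 / 2) *
      Real.exp (-((M / ε) ^ ((1 : ℝ) / m) / 240 *
        (stdGaussianPi (n + 1)).real {x | |MvPolynomial.eval x q| ≤ ε})) := by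
  have hc : Continuous fun x => |MvPolynomial.eval x q| := q.continuous_eval.abs
  set κ : ℝ := (M / ε) ^ ((1 : ℝ) / m) / 240 with hκ
  have hκ0 : 0 ≤ κ := by positivity
  have hκ' : κ ≤ (M / 2 / (2 * ε)) ^ ((1 : ℝ) / m) / 60 := by
    have e : M / 2 / (2 * ε) = 1 / 4 * (M / ε) := by field_simp; norm_num
    have h4 : (1 / 4 : ℝ) ≤ (1 / 4) ^ ((1 : ℝ) / m) := by
      refine Real.self_le_rpow_of_le_one (by norm_num) (by norm_num) ?_
      rw [div_le_one (by positivity)]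
      exact_mod_cast hm
    rw [e, Real.mul_rpow (by norm_num) (by positivity), hκ]
    have := mul_le_mul_of_nonneg_right h4
      (show 0 ≤ (M / ε) ^ ((1 : ℝ) / m) by positivity)
    linarith
  set A : ℝ := 2 * Real.exp (3 / 2) with hA
  have hA0 : 0 ≤ A := by positivity
  set f : (Fin (n + 1) → ℝ) → ℝ := fun x => cutoff (|MvPolynomial.eval x q| / ε) with hf
  set g : (Fin (n + 1) → ℝ) → ℝ := fun x => 1 - cutoff (2 * |MvPolynomial.eval x q| / M) with hg
  have hfc : Continuous f := continuous_cutoff.comp (by fun_prop)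
  have hgc : Continuous g := continuous_const.sub (continuous_cutoff.comp (by fun_prop))
  have hf01 : ∀ x, f x ∈ Icc (0 : ℝ) 1 := fun x => cutoff_mem_Icc _
  have hg01 : ∀ x, g x ∈ Icc (0 : ℝ) 1 := fun x => by
    have := cutoff_mem_Icc (2 * |MvPolynomial.eval x q| / M)
    exact ⟨sub_nonneg.2 this.2, sub_le_self _ this.1⟩
  have key := gaussian_needle hfc hgc hf01 hg01 (Θ := fun x => A * Real.exp (-(κ * x)))
    (L := fun x => -(A * κ * Real.exp (-(κ * x)))) (K := A * κ ^ 2 * Real.exp κ)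
    (by positivity) (by fun_prop) (fun x => by positivity)
    (fun x hx y hy => exp_neg_quadratic_bound hA0 hκ0 hx hy) ?_
  · have h1 : (stdGaussianPi (n + 1)).real {x | M ≤ |MvPolynomial.eval x q|} ≤
        ∫ x, g x ∂(stdGaussianPi (n + 1)) :=
      measureReal_le_integral hgc.measurable hg01
        (measurableSet_le measurable_const hc.measurable) fun x hx => by
          have hx : M ≤ |MvPolynomial.eval x q| := hx
          simp only [hg]
          rw [cutoff_of_two_le, sub_zero]
          rw [le_div_iff₀ hM]
          linarith
    have h2 : (stdGaussianPi (n + 1)).real {x | |MvPolynomial.eval x q| ≤ ε} ≤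
        ∫ x, f x ∂(stdGaussianPi (n + 1)) :=
      measureReal_le_integral hfc.measurable hf01
        (measurableSet_le hc.measurable measurable_const) fun x hx =>
          cutoff_of_le_one ((div_le_one hε).2 hx)
    refine h1.trans (key.trans ?_)
    gcongr
  · intro a w
    obtain ⟨r, hr, hre⟩ := exists_polynomial_eval_add_smul hq a w
    have hline : Continuous fun t : ℝ => a + t • w := by fun_prop
    have hrc : Continuous fun t => |r.eval t| := r.continuous.abs
    have h1 : ∫ t, g (a + t • w) ∂(gaussianReal 0 1) ≤
        (gaussianReal 0 1).real {t | M / 2 ≤ |r.eval t|} :=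
      integral_le_measureReal (hgc.comp hline).measurable (fun t => hg01 _)
        (measurableSet_le measurable_const hrc.measurable) fun t ht => by
          have ht : |r.eval t| < M / 2 := not_le.1 ht
          refine sub_eq_zero.2 (cutoff_of_le_one ?_).symm
          rw [← hre, div_le_one hM]
          linarith
    have h2 : ∫ t, f (a + t • w) ∂(gaussianReal 0 1) ≤
        (gaussianReal 0 1).real {t | |r.eval t| ≤ 2 * ε} :=
      integral_le_measureReal (hfc.comp hline).measurable (fun t => hf01 _)
        (measurableSet_le hrc.measurable measurable_const) fun t ht => by
          have ht : 2 * ε < |r.eval t| := not_le.1 ht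
          refine cutoff_of_two_le ?_
          rw [← hre, le_div_iff₀ hε]
          exact ht.le
    have hf0 : 0 ≤ ∫ t, f (a + t • w) ∂(gaussianReal 0 1) :=
      integral_nonneg fun t => (hf01 _).1
    refine h1.trans ((gaussianReal_polynomial_tail hm hr (ε := 2 * ε) (M := M / 2)
      (by positivity) (by positivity)).trans ?_)
    gcongr

/-- Anticoncentration of a polynomial with second moment at least one. -/
theorem stdGaussianPi_abs_eval_le {n m : ℕ} (hm : 0 < m) {q : MvPolynomial (Fin (n + 1)) ℝ}
    (hq : q.totalDegree ≤ m) (h1 : 1 ≤ ∫ x, MvPolynomial.eval x q ^ 2 ∂(stdGaussianPi (n + 1)))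
    {ε : ℝ} (hε : 0 < ε) :
    (stdGaussianPi (n + 1)).real {x | |MvPolynomial.eval x q| ≤ ε} ≤
      960 * Real.exp (3 / 2) * m * ε ^ ((1 : ℝ) / m) := by
  set F := (stdGaussianPi (n + 1)).real {x | |MvPolynomial.eval x q| ≤ ε} with hF
  rcases (measureReal_nonneg : 0 ≤ F).eq_or_lt with h0 | hpos
  · rw [show F = 0 from h0.symm]
    positivity
  have hA : 1 ≤ 2 * Real.exp (3 / 2) := by
    have := Real.one_le_exp (show (0 : ℝ) ≤ 3 / 2 by norm_num)
    linarith
  have hε' : 0 < ε ^ ((1 : ℝ) / m) := by positivity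
  set b := F / (240 * ε ^ ((1 : ℝ) / m)) with hb
  have hb0 : 0 < b := by positivity
  have h2 := integral_sq_le_of_tail (μ := stdGaussianPi (n + 1)) q.continuous_eval.measurable
    (A := 2 * Real.exp (3 / 2)) (by positivity) hb0 hm fun M hM => by
      refine (stdGaussianPi_polynomial_tail hm hq hε hM).trans (le_of_eq ?_)
      rw [← hF, hb, Real.div_rpow hM.le hε.le]
      congr 3
      field_simp
  have h3 := h1.trans h2
  rw [le_div_iff₀ (by positivity), one_mul] at h3
  have h4 := le_of_pow_le_mul_factorial hm hA h3
  rw [hb, div_le_iff₀ (by positivity)] at h4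
  linarith

theorem one_le_integral_sub_sq {Ω : Type*} [MeasurableSpace Ω] {μ : Measure Ω}
    [IsProbabilityMeasure μ] {f : Ω → ℝ} (hf : AEStronglyMeasurable f μ)
    (h0 : ∫ x, f x ∂μ = 0) (h1 : ∫ x, f x ^ 2 ∂μ = 1) (t : ℝ) :
    1 ≤ ∫ x, (f x - t) ^ 2 ∂μ := by
  have i2 : Integrable (fun x => f x ^ 2) μ := by
    by_contra h
    rw [integral_undef h] at h1
    exact zero_ne_one h1
  have i1 : Integrable f μ := ((memLp_two_iff_integrable_sq hf).2 i2).integrable (by norm_num)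
  have : ∫ x, (f x - t) ^ 2 ∂μ = 1 + t ^ 2 := by
    have e : ∀ x, (f x - t) ^ 2 = f x ^ 2 - 2 * t * f x + t ^ 2 := fun x => by ring
    simp_rw [e]
    rw [integral_add (by exact i2.sub (i1.const_mul _)) (integrable_const _),
      integral_sub i2 (i1.const_mul _), integral_const_mul, h0, h1]
    simp
  rw [this]
  nlinarith [sq_nonneg t]

/-- **Carbery–Wright application.** For a degree-`m` polynomial `p` with mean
zero and variance one under `N(0,I_d)` and `y = p(x)`, for any `τ` and `ε > 0`,
`Pr[|y| ∈ (τ − ε, τ)] ≤ C·m·ε^{1/m}` for a universal constant `C > 0`. -/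
theorem stmt_18 :
    ∃ C : ℝ, 0 < C ∧ ∀ (d m : ℕ), 0 < m → ∀ (p : MvPolynomial (Fin d) ℝ),
      p.totalDegree ≤ m →
      (∫ x, MvPolynomial.eval x p ∂(stdGaussianPi d)) = 0 →
      (∫ x, (MvPolynomial.eval x p) ^ 2 ∂(stdGaussianPi d)) = 1 →
      ∀ (τ ε : ℝ), 0 < ε →
        ((stdGaussianPi d) {x | |MvPolynomial.eval x p| ∈ Set.Ioo (τ - ε) τ}).toReal ≤
          C * m * ε ^ ((1 : ℝ) / m) := by
  refine ⟨2 * (960 * Real.exp (3 / 2)), by positivity, ?_⟩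
  rintro (_ | n) m hm p hp h0 h1 τ ε hε
  · have e : ∀ x : Fin 0 → ℝ, MvPolynomial.eval x p = MvPolynomial.eval 0 p := fun x => by
      rw [Subsingleton.elim x 0]
    simp only [e, integral_const, probReal_univ, one_smul] at h0 h1
    rw [h0] at h1
    norm_num at h1
  have key : ∀ t, (stdGaussianPi (n + 1)).real {x | |MvPolynomial.eval x p - t| ≤ ε} ≤
      960 * Real.exp (3 / 2) * m * ε ^ ((1 : ℝ) / m) := by
    intro t
    have := stdGaussianPi_abs_eval_le (q := p - MvPolynomial.C t) hm
      ((MvPolynomial.totalDegree_sub_C_le p t).trans hp) (by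
        simpa using one_le_integral_sub_sq p.continuous_eval.aestronglyMeasurable h0 h1 t) hε
    simpa using this
  have hsub : {x | |MvPolynomial.eval x p| ∈ Set.Ioo (τ - ε) τ} ⊆
      {x | |MvPolynomial.eval x p - τ| ≤ ε} ∪ {x | |MvPolynomial.eval x p - (-τ)| ≤ ε} := by
    rintro x ⟨hx1, hx2⟩
    rcases abs_cases (MvPolynomial.eval x p) with h | h <;> rw [h.1] at hx1 hx2
    · left
      rw [mem_ofPred_eq, abs_le]
      constructor <;> linarith
    · right
      rw [mem_ofPred_eq, abs_le]
      constructor <;> linarith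
  change (stdGaussianPi (n + 1)).real _ ≤ _
  calc _ ≤ _ := measureReal_mono hsub
    _ ≤ _ := measureReal_union_le _ _
    _ ≤ _ := add_le_add (key _) (key _)
    _ = _ := by ring
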